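/- arXiv:2310.16404 — 2 statements merged into one kernel-verified Lean document; each statement's English description precedes it below -/
import Mathlib

section
/- (Accelerated linearized ALM, Nesterov's second scheme, strongly convex case.) Consider minimizing g(y) = g1(y) + g2(y) over y ∈ ℝ^n subject to By = b, where g1 : ℝ^n → ℝ is lower semicontinuous and μ_g-strongly convex (μ_g > 0), g2 : ℝ^n → ℝ is convex and differentiable with L_{g2}-Lipschitz gradient, and the saddle point set Ω of the Lagrangian 𝓛(y,λ) = g(y) + ⟨λ, By − b⟩ is nonempty. Let (y*, λ*) ∈ Ω. Let the iterates, started from y_1 = y_0 ∈ ℝ^n, v_1 = y_1, λ_1 ∈ ℝ^p, with β, γ > 0 and {t_k}_{k≥1} ⊆ [1, +∞) nondecreasing satisfying t_{k+1}² ≤ t_k² + t_{k+1} and t_{k+1}² ≤ t_k² + β·μ_g·t_k, be given for k ≥ 1 by: ȳ_k = y_k + ((t_k − 1)/t_{k+1})·(y_k − y_{k−1}); λ̄_{k+1} = λ_k + γ·t_{k+1}·(B v_k − b); v_{k+1} − v_k = −(β/t_{k+1})·(ζ_{k+1} + ∇g2(ȳ_k) + Bᵀλ̄_{k+1} + μ_g·(v_{k+1}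 − y_{k+1})) for some ζ_{k+1} ∈ ∂g1(y_{k+1}); v_{k+1} = y_{k+1} + (t_{k+1} − 1)·(y_{k+1} − y_k); λ_{k+1} = λ_k + γ·t_{k+1}·(B v_{k+1} − b). If β ≤ t_1²/(L_{g2} + t_1²·γ·‖B‖²), then for all k ≥ 1: ‖B y_k − b‖ ≤ C_4/t_k² and |g(y_k) − g(y*)| ≤ (E_1 + C_4·‖λ*‖)/t_k², where E_1 = t_1²·(g(y_1) − g(y*) + ⟨λ*, B y_1 − b⟩) + (t_1²/(2β))·‖y_1 − y*‖² + (1/(2γ))·‖λ_1 − λ*‖² and C_4 = 3·t_1²·‖B y_1 − b‖ + (2‖λ_1 − λ*‖ + 2√(2γ·E_1))/γ. -/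
set_option autoImplicit false

open RealInnerProductSpace

lemma le_harmonic {x h Q : ℝ} (hx : 0 < x) (hh : 0 < h) (H : Q ^ 2 ≤ (x - Q) * (h - Q)) :
    Q ≤ x * h / (x + h) := by
  rw [le_div_iff₀ (by positivity)]
  nlinarith

lemma gap_lower {T u : ℝ} (hT : 1 ≤ T) (hTu : T ≤ u) (hu : u ^ 2 ≤ T ^ 2 + u) :
    1 ≤ (2 - 1 / (2 * u)) * (2 * u - (u ^ 2 - T ^ 2) - T) := by
  have hu0 : 0 < u := by linarith
  have h1 : 2 - 1 / (2 * u) = (4 * u - 1) / (2 * u) := by field_simp; ring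
  rw [h1, div_mul_eq_mul_div, le_div_iff₀ (by positivity)]
  have h2 : (4 * u - 1) / (4 * (2 * u - 1)) ≤ 2 * u - (u ^ 2 - T ^ 2) - T := by
    rw [div_le_iff₀ (by linarith)]
    nlinarith [sq_nonneg (T - u + 1 / 2), mul_nonneg (sub_nonneg.2 hu) (by linarith : 0 ≤ u - 1)]
  have h3 : 2 * u ≤ (4 * u - 1) * ((4 * u - 1) / (4 * (2 * u - 1))) := by
    rw [mul_div_assoc', le_div_iff₀ (by linarith)]
    nlinarith
  nlinarith [mul_le_mul_of_nonneg_left h2 (by linarith : 0 ≤ 4 * u - 1)]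

lemma gap_lower_linear {T u : ℝ} (hT : 1 ≤ T) (hTu : T ≤ u) :
    u - (u ^ 2 - T ^ 2) * (1 - 1 / (2 * u)) ≤ 2 * u - (u ^ 2 - T ^ 2) - T := by
  have hu0 : 0 < u := by linarith
  have : (u ^ 2 - T ^ 2) * (1 / (2 * u)) ≤ u - T := by
    rw [mul_one_div, div_le_iff₀ (by positivity)]
    nlinarith
  linarith

lemma one_le_mul_of {K N c d : ℝ} (hd : 0 < d) (hN : d ≤ N) (hc : 1 ≤ c * d) (hK : c ≤ K) :
    1 ≤ K * N := by
  have hc0 : 0 < c := by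
    by_contra h
    nlinarith
  nlinarith [mul_le_mul hK hN hd.le (hc0.le.trans hK)]

lemma coupling_init {τ σ s : ℝ} (hτ : 1 ≤ τ) (hσ : 0 < σ) (hs : s ^ 2 = τ ^ 2 + σ * τ)
    (hs0 : 0 < s) (hσs : σ * τ ≤ s) :
    1 ≤ (1 - σ * (1 - 1 / s) ^ 2 + τ) * (2 * s - (s ^ 2 - τ ^ 2) - τ) := by
  have hτs : τ ≤ s := by nlinarith [mul_pos hσ (by linarith : 0 < τ)]
  have hN := gap_lower hτ hτs (by nlinarith)
  refine hN.trans (mul_le_mul_of_nonneg_right ?_ (by by_contra! h; nlinarith))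
  -- `σ (1 - 1/s)² ≤ τ / 4`
  have h1 : σ * (1 - 1 / s) ^ 2 ≤ τ / 4 := by
    have e : σ * (1 - 1 / s) ^ 2 = σ * (s - 1) ^ 2 / s ^ 2 := by field_simp
    rw [e, div_le_iff₀ (by positivity)]
    have h2 : σ * τ * (s - 1) ≤ τ ^ 2 := by nlinarith
    have h3 : τ * (σ * (s - 1)) ≤ τ * τ := by nlinarith
    have h4 : σ * (s - 1) ≤ τ := le_of_mul_le_mul_left h3 (by linarith)
    nlinarith [mul_le_mul_of_nonneg_right h4 (by linarith : 0 ≤ s - 1), sq_nonneg (s - 2)]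
  rcases le_total s 2 with h | h
  · have : 1 / 4 ≤ 1 / (2 * s) := by
      apply one_div_le_one_div_of_le <;> linarith
    linarith
  · have : 0 ≤ 1 / (2 * s) := by positivity
    nlinarith

lemma le_harmonic_div {σ r T Q : ℝ} (hσ : 0 < σ) (hr : 0 ≤ r) (hT : 0 < T)
    (hQ : σ * Q ^ 2 ≤ (σ + r - σ * Q) * (T + σ - Q)) :
    Q ≤ (1 + r / σ) * (T + σ) / (1 + r / σ + (T + σ)) := by
  apply le_harmonic (by positivity) (by positivity)
  have : (σ + r - σ * Q) * (T + σ - Q) = σ * ((1 + r / σ - Q) * (T + σ - Q)) := by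
    field_simp
  rw [this] at hQ
  exact le_of_mul_le_mul_left hQ hσ

lemma coupling_small {σ T u r : ℝ} (hσ : 0 < σ) (hσφ : σ ≤ 1.6181) (hT : 1 ≤ T)
    (hTu : T ≤ u) (hr : 0 ≤ r) :
    3 / (u + 1) ≤ 1 - σ * ((u - 1) ^ 2 / u ^ 2) +
      (1 + r / σ) * (T + σ) / (1 + r / σ + (T + σ)) := by
  have hu1 : 1 ≤ u := by linarith
  have hu0 : 0 < u := by linarith
  have hg : 1 / 2 + 0.138 * σ ≤ (1 + r / σ) * (T + σ) / (1 + r / σ + (T + σ)) := by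
    apply le_harmonic_div hσ hr (by linarith)
    have a4 : (1 / 2 + 0.138 * σ) ^ 2 ≤ (1 / 2 - 0.138 * σ) * (1 / 2 + 0.862 * σ) := by
      nlinarith
    calc σ * (1 / 2 + 0.138 * σ) ^ 2
        ≤ σ * ((1 / 2 - 0.138 * σ) * (1 / 2 + 0.862 * σ)) := by gcongr
      _ = (σ * (1 / 2 - 0.138 * σ)) * (1 / 2 + 0.862 * σ) := by ring
      _ ≤ _ := by
        have : 0 ≤ σ * (1 / 2 - 0.138 * σ) := mul_nonneg hσ.le (by linarith)
        apply mul_le_mul <;> linarith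
  have e3 : 3 / (u + 1) = 3 / 2 - 3 / 2 * (u - 1) / (u + 1) := by field_simp; ring
  have e4 : 0 ≤ 3 / 2 * (u - 1) / (u + 1) := by
    apply div_nonneg <;> linarith
  have key : σ * ((u - 1) ^ 2 / u ^ 2 - 0.138) ≤ 3 / 2 * (u - 1) / (u + 1) := by
    rcases le_total ((u - 1) ^ 2 / u ^ 2) 0.138 with h2 | h2
    · exact (mul_nonpos_of_nonneg_of_nonpos hσ.le (by linarith)).trans e4
    · have : 1.6181 * ((u - 1) ^ 2 / u ^ 2 - 0.138) ≤ 3 / 2 * (u - 1) / (u + 1) := by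
        have e5 : 1.6181 * ((u - 1) ^ 2 / u ^ 2 - 0.138)
            = (1.6181 * ((u - 1) ^ 2 - 0.138 * u ^ 2)) / u ^ 2 := by field_simp
        rw [e5, div_le_div_iff₀ (by positivity) (by positivity)]
        nlinarith [pow_nonneg (sub_nonneg.2 hu1) 3, sq_nonneg (u - 1)]
      exact (mul_le_mul_of_nonneg_right hσφ (by linarith)).trans this
  linarith

lemma coupling_medium {σ T u r : ℝ} (hσ : 0 < σ) (hσφ : σ ≤ 1.6181) (hT : 1 + σ ≤ T ^ 2)
    (hT1 : 1 ≤ T) (hTu : T ≤ u) (hr : T ^ 2 = u ^ 2 - r) (h1 : 2 / 3 * u ≤ r)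
    (h2 : r ≤ 0.9 * u) :
    1 / (0.1 * u + 0.45) ≤ 1 - σ * ((u - 1) ^ 2 / u ^ 2) +
      (1 + r / σ) * (T + σ) / (1 + r / σ + (T + σ)) := by
  have hu0 : 0 < u := by linarith
  have hu1 : 1.387 ≤ u := by nlinarith
  rcases le_total u 2 with h3 | h3
  · have hg : 1 ≤ (1 + r / σ) * (T + σ) / (1 + r / σ + (T + σ)) := by
      apply le_harmonic_div hσ (by linarith) (by linarith)
      have h4 : σ / 3 ≤ T - 1 := by nlinarith
      have h5 : 0.92 * (4 / 3 * σ) ≤ r * (T + σ - 1) := by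
        apply mul_le_mul <;> linarith
      linarith
    have b1 : (u - 1) ^ 2 / u ^ 2 ≤ 1 / 4 := by
      rw [div_le_iff₀ (by positivity)]; nlinarith
    have b2 : σ ≤ u ^ 2 - 2 / 3 * u - 1 := by linarith
    have b4 : 0 ≤ (u - 1.387) * (2 - u) := mul_nonneg (by linarith) (by linarith)
    have b3 : 1 / (0.1 * u + 0.45) ≤ 2.07 - 0.264 * u := by
      rw [div_le_iff₀ (by positivity)]; nlinarith
    have b5 : σ * ((u - 1) ^ 2 / u ^ 2) ≤ σ * (1 / 4) := by gcongr
    nlinarith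
  · have hg : 1.1 ≤ (1 + r / σ) * (T + σ) / (1 + r / σ + (T + σ)) := by
      apply le_harmonic_div hσ (by linarith) (by linarith)
      have h4 : 1.4 ≤ T := by nlinarith
      have h5 : 1.17 * (0.3 + σ) ≤ (r - 0.1 * σ) * (T + σ - 1.1) := by
        apply mul_le_mul <;> linarith
      linarith
    have b1 : σ * ((u - 1) ^ 2 / u ^ 2) ≤ 1.6181 * ((u - 1) ^ 2 / u ^ 2) := by gcongr
    suffices 1 / (0.1 * u + 0.45) + 1.6181 * ((u - 1) ^ 2 / u ^ 2) ≤ 2.1 by linarith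
    rw [mul_div_assoc', div_add_div _ _ (by positivity) (by positivity),
      div_le_iff₀ (by positivity)]
    have c1 : 0 ≤ (u - 1.03) * (u - 4.25) ^ 2 := mul_nonneg (by linarith) (sq_nonneg _)
    have c2 : 0 ≤ u * (u - 5.5) ^ 2 := by positivity
    linarith

lemma coupling_large {σ T u r : ℝ} (hσ : 0 < σ) (hσφ : σ ≤ 1.6181) (hT : 1 + σ ≤ T ^ 2)
    (hT1 : 1 ≤ T) (hTu : T ≤ u) (hr : T ^ 2 = u ^ 2 - r) (h1 : 0.9 * u ≤ r) (h2 : r ≤ u) :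
    2 - 1 / (2 * u) ≤ 1 - σ * ((u - 1) ^ 2 / u ^ 2) +
      (1 + r / σ) * (T + σ) / (1 + r / σ + (T + σ)) := by
  have hu0 : 0 < u := by linarith
  rcases le_total u 1.94 with h3 | h3
  · have hu1 : 1.5 ≤ u := by nlinarith
    have hg : 1 ≤ (1 + r / σ) * (T + σ) / (1 + r / σ + (T + σ)) := by
      apply le_harmonic_div hσ (by linarith) (by linarith)
      have h5 : 1 * σ ≤ r * (T + σ - 1) := by
        apply mul_le_mul <;> linarith
      linarith
    have b2 : σ ≤ 1.018 := by nlinarith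
    have b3 : (u - 1) ^ 2 / u ^ 2 ≤ 0.2349 := by
      rw [div_le_iff₀ (by positivity)]; nlinarith
    have b4 : 0.2577 ≤ 1 / (2 * u) := by
      rw [le_div_iff₀ (by positivity)]; linarith
    have b6 : σ * ((u - 1) ^ 2 / u ^ 2) ≤ 1.018 * 0.2349 := by gcongr
    linarith
  · have hTl : u - 0.59 ≤ T := by
      refine (sq_le_sq₀ (by linarith) (by linarith)).1 ?_
      nlinarith
    have e : (u - 1) ^ 2 / u ^ 2 = (1 - 1 / u) ^ 2 := by field_simp
    have e' : 1 / (2 * u) = 1 / u / 2 := by field_simp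
    rw [e, e']
    obtain ⟨i, hi⟩ : ∃ i, i = 1 / u := ⟨_, rfl⟩
    have hiu : i * u = 1 := by rw [hi]; field_simp
    have hi0 : 0 < i := by rw [hi]; positivity
    have hi1 : i ≤ 0.5182 := by
      have := mul_nonneg hi0.le (sub_nonneg.2 h3)
      linarith
    have hui : 4 - 4 * i ≤ u := by
      have := mul_nonneg hi0.le (sq_nonneg (u - 2))
      have e2 : i * (u - 2) ^ 2 = u - 4 + 4 * i := by linear_combination (u - 4) * hiu
      linarith
    have hii : 0 ≤ i * (0.5182 - i) := mul_nonneg hi0.le (by linarith)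
    rw [← hi]
    obtain ⟨Q, hQ⟩ : ∃ Q, Q = 1 - i / 2 + 1.6181 * (1 - i) ^ 2 := ⟨_, rfl⟩
    have hQ1 : 1 ≤ Q := by
      have := mul_nonneg (by linarith : 0 ≤ 0.5182 - i) (by linarith : 0 ≤ 1 - i)
      linarith
    have hQT : Q ≤ u - 0.59 := by linarith
    have hend : 1.6181 * Q ^ 2 ≤ (0.9 * u - 1.6181 * (Q - 1)) * (u + 1.0281 - Q) := by
      have e3 : u * Q = 2.6181 * u - 3.7362 + 1.6181 * i := by
        rw [hQ]; linear_combination (-3.7362 + 1.6181 * i) * hiu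
      have := sq_nonneg (u - 2.2496 - 1.1526 * i)
      have := mul_nonneg hi0.le (by linarith : 0 ≤ 3.519 - 6.506 * i)
      nlinarith
    have hg : Q ≤ (1 + r / σ) * (T + σ) / (1 + r / σ + (T + σ)) := by
      apply le_harmonic_div hσ (by linarith) (by linarith)
      have h6 : σ * (Q - 1) ≤ 1.6181 * (Q - 1) := by gcongr
      have h7 : 0 < 0.9 * u - 1.6181 * (Q - 1) := by
        linarith
      have h8 : (0.9 * u - σ * (Q - 1)) * (u - 0.59 + σ - Q) ≤
          (σ + r - σ * Q) * (T + σ - Q) := by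
        apply mul_le_mul <;> linarith
      -- concavity in `σ`
      have h9 : 0 ≤ (1.6181 - σ) * (0.9 * u * (u - 0.59 - Q)) := by
        apply mul_nonneg (by linarith)
        apply mul_nonneg <;> linarith
      have h10 : 0 ≤ σ * (1.6181 - σ) * (Q - 1) := by
        apply mul_nonneg (mul_nonneg hσ.le _) <;> linarith
      have h11 := mul_le_mul_of_nonneg_left hend hσ.le
      linarith
    nlinarith [mul_le_mul_of_nonneg_right hσφ (sq_nonneg (1 - i))]

lemma coupling {σ T u : ℝ} (hσ : 0 < σ) (hσ2 : σ ^ 2 ≤ 1 + σ) (hT : 1 + σ ≤ T ^ 2)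
    (hT0 : 0 < T) (hTu : T ≤ u) (hu : u ^ 2 ≤ T ^ 2 + u) :
    1 ≤ (1 - σ * (1 - 1 / u) ^ 2 + (1 + (u ^ 2 - T ^ 2) / σ) * (T + σ) /
      ((1 + (u ^ 2 - T ^ 2) / σ) + (T + σ))) * (2 * u - (u ^ 2 - T ^ 2) - T) := by
  have hT1 : 1 ≤ T := by nlinarith
  have hu0 : 0 < u := by linarith
  have hσφ : σ ≤ 1.6181 := by nlinarith
  have hN2 := gap_lower hT1 hTu hu
  have hN1 := gap_lower_linear hT1 hTu
  obtain ⟨r, hr⟩ : ∃ r, u ^ 2 - T ^ 2 = r := ⟨_, rfl⟩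
  rw [hr] at hN1 hN2 ⊢
  have hr0 : 0 ≤ r := by nlinarith
  have hru : r ≤ u := by linarith
  have hP : (1 - 1 / u) ^ 2 = (u - 1) ^ 2 / u ^ 2 := by field_simp
  have hinv : 1 / (2 * u) * u = 1 / 2 := by field_simp
  have h5 : 0 ≤ 1 - 1 / (2 * u) := by
    rw [sub_nonneg, div_le_one (by positivity)]; linarith
  rw [hP]
  rcases le_total r (2 / 3 * u) with h1 | h1
  · refine one_le_mul_of (d := (u + 1) / 3) (by positivity) ?_ (le_of_eq (by field_simp))
      (coupling_small hσ hσφ hT1 hTu hr0)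
    nlinarith [mul_le_mul_of_nonneg_right h1 h5]
  rcases le_total r (0.9 * u) with h2 | h2
  · refine one_le_mul_of (d := 0.1 * u + 0.45) (by positivity) ?_ (le_of_eq (by field_simp))
      (coupling_medium hσ hσφ hT hT1 hTu (by linarith) h1 h2)
    nlinarith [mul_le_mul_of_nonneg_right h2 h5]
  · refine hN2.trans (mul_le_mul_of_nonneg_right
      (coupling_large hσ hσφ hT hT1 hTu (by linarith) h2 hru) ?_)
    nlinarith [one_div_pos.2 (by positivity : 0 < 2 * u)]

section
variable {E : Type*} [NormedAddCommGroup E] [InnerProductSpace ℝ E]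

theorem StrongConvexOn.add_sq_norm_sub_le_of_isMin {F : E → ℝ} {μ : ℝ} {x : E}
    (hF : StrongConvexOn Set.univ μ F) (hx : ∀ z, F x ≤ F z) (z : E) :
    F x + μ / 2 * ‖z - x‖ ^ 2 ≤ F z := by
  by_contra! hlt
  obtain ⟨d, hd⟩ : ∃ d, d = F x + μ / 2 * ‖z - x‖ ^ 2 - F z := ⟨_, rfl⟩
  have hd0 : 0 < d := by linarith
  obtain ⟨c, hc⟩ : ∃ c, c = μ / 2 * ‖z - x‖ ^ 2 := ⟨_, rfl⟩
  have hc0 : d ≤ c := by have := hx z; linarith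
  have hca : 0 < c := by linarith
  have key : ∀ a : ℝ, 0 ≤ a → a ≤ 1 → a * d ≤ a * (a * c) := by
    intro a h0 h1
    have h := hF.2 (Set.mem_univ z) (Set.mem_univ x) h0 (sub_nonneg.2 h1) (by ring)
    have h2 := hx (a • z + (1 - a) • x)
    simp only [smul_eq_mul] at h
    have : a * (1 - a) * (μ / 2 * ‖z - x‖ ^ 2) = a * (1 - a) * c := by rw [hc]
    have : a * d = a * (F x + c - F z) := by rw [hd, hc]
    linarith
  have hq : 0 < d / (2 * c) := by positivity
  have h := key (d / (2 * c)) hq.le (by rw [div_le_one (by positivity)]; linarith)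
  have h' := le_of_mul_le_mul_left h hq
  have : d / (2 * c) * c = d / 2 := by field_simp
  linarith

theorem StrongConvexOn.add_inner {F : E → ℝ} {μ : ℝ}
    (hF : StrongConvexOn Set.univ μ F) (w : E) (c : ℝ) :
    StrongConvexOn Set.univ μ (fun z => F z + (⟪w, z⟫ + c)) := by
  refine ⟨convex_univ, fun x _ y _ a b ha hb hab => ?_⟩
  have h := hF.2 (Set.mem_univ x) (Set.mem_univ y) ha hb hab
  simp only [smul_eq_mul, inner_add_right, inner_smul_right] at h ⊢
  have : c = a * c + b * c := by rw [← add_mul, hab, one_mul]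
  linarith

theorem StrongConvexOn.subgradient_ineq {F : E → ℝ} {μ : ℝ} {x w : E}
    (hF : StrongConvexOn Set.univ μ F) (hw : ∀ z, F x + ⟪w, z - x⟫ ≤ F z) (z : E) :
    F x + ⟪w, z - x⟫ + μ / 2 * ‖z - x‖ ^ 2 ≤ F z := by
  have h := (hF.add_inner (-w) 0).add_sq_norm_sub_le_of_isMin (x := x) (fun z => by
    have := hw z
    simp only [inner_neg_left, inner_sub_right] at this ⊢
    linarith) z
  simp only [inner_neg_left, inner_sub_right] at h ⊢
  linarith

variable [CompleteSpace E]

theorem HasGradientAt.hasDerivAt_lineMap {f : E → ℝ} {x z w : E} {s : ℝ}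
    (h : HasGradientAt f w (x + s • (z - x))) :
    HasDerivAt (fun s : ℝ => f (x + s • (z - x))) ⟪w, z - x⟫ s := by
  have h1 : HasDerivAt (fun s : ℝ => x + s • (z - x)) (z - x) s := by
    simpa using ((hasDerivAt_id s).smul_const (z - x)).const_add x
  simpa [Function.comp_def] using h.hasFDerivAt.comp_hasDerivAt s h1

theorem ConvexOn.gradient_ineq {f : E → ℝ} {x w : E} (hf : ConvexOn ℝ Set.univ f)
    (h : HasGradientAt f w x) (z : E) : f x + ⟪w, z - x⟫ ≤ f z := by
  have h1 : HasDerivAt (fun s : ℝ => f (x + s • (z - x))) ⟪w, z - x⟫ 0 :=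
    HasGradientAt.hasDerivAt_lineMap (by simpa using h)
  have hc : ConvexOn ℝ Set.univ (fun s : ℝ => f (x + s • (z - x))) := by
    have := hf.comp_affineMap (AffineMap.lineMap x z)
    simpa [Function.comp_def, AffineMap.lineMap_apply, add_comm] using this
  have := hc.le_slope_of_hasDerivAt (Set.mem_univ 0) (Set.mem_univ 1) one_pos h1
  simp [slope_def_field] at this
  linarith

theorem le_add_inner_add_sq_of_lipschitz_gradient {f : E → ℝ} {f' : E → E} {L : ℝ}
    (hf : ∀ x, HasGradientAt f (f' x) x) (hL : ∀ x z, ‖f' x - f' z‖ ≤ L * ‖x - z‖) (x z : E) :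
    f z ≤ f x + ⟪f' x, z - x⟫ + L / 2 * ‖z - x‖ ^ 2 := by
  let q : ℝ → ℝ := fun s => f (x + s • (z - x)) - s * ⟪f' x, z - x⟫ - L / 2 * ‖z - x‖ ^ 2 * s ^ 2
  have hq : ∀ s, HasDerivAt q (⟪f' (x + s • (z - x)), z - x⟫ - ⟪f' x, z - x⟫
      - L / 2 * ‖z - x‖ ^ 2 * (2 * s)) s := fun s => by
    refine ((HasGradientAt.hasDerivAt_lineMap (hf _)).sub ?_).sub ?_
    · simpa using (hasDerivAt_id s).mul_const ⟪f' x, z - x⟫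
    · simpa using (hasDerivAt_pow 2 s).const_mul (L / 2 * ‖z - x‖ ^ 2)
  have hanti : AntitoneOn q (Set.Icc 0 1) := by
    refine antitoneOn_of_deriv_nonpos (convex_Icc 0 1)
      (fun s _ => (hq s).continuousAt.continuousWithinAt)
      (fun s _ => (hq s).differentiableAt.differentiableWithinAt) fun s hs => ?_
    rw [interior_Icc] at hs
    rw [(hq s).deriv, ← inner_sub_left]
    have h1 := real_inner_le_norm (f' (x + s • (z - x)) - f' x) (z - x)
    have h2 := hL (x + s • (z - x)) x
    rw [add_sub_cancel_left, norm_smul, Real.norm_of_nonneg hs.1.le] at h2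
    nlinarith [mul_le_mul_of_nonneg_right h2 (norm_nonneg (z - x))]
  have := hanti (by simp) (by simp) zero_le_one
  simp [q] at this
  linarith
end

section
variable {E F : Type*} [NormedAddCommGroup E] [InnerProductSpace ℝ E] [CompleteSpace E]
  [NormedAddCommGroup F] [InnerProductSpace ℝ F] [CompleteSpace F]

theorem composite_ineq {g1 g2 : E → ℝ} {g2' : E → E} {L μ : ℝ}
    (hg1 : StrongConvexOn Set.univ μ g1) (hg2 : ConvexOn ℝ Set.univ g2)
    (hgrad : ∀ y, HasGradientAt g2 (g2' y) y)
    (hlip : ∀ x y, ‖g2' x - g2' y‖ ≤ L * ‖x - y‖) {y' ybar ζ : E}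
    (hζ : ∀ z, g1 y' + ⟪ζ, z - y'⟫ ≤ g1 z) (z : E) :
    g1 y' + g2 y' + μ / 2 * ‖z - y'‖ ^ 2 ≤
      g1 z + g2 z + ⟪ζ + g2' ybar, y' - z⟫ + L / 2 * ‖y' - ybar‖ ^ 2 := by
  have h1 := hg1.subgradient_ineq hζ z
  have h2 := hg2.gradient_ineq (hgrad ybar) z
  have h3 := le_add_inner_add_sq_of_lipschitz_gradient hgrad hlip ybar y'
  simp only [inner_sub_right, inner_add_left] at *
  linarith

theorem energy_step {B : E →L[ℝ] F} {g1 g2 : E → ℝ} {g2' : E → E} {L μ β γ u : ℝ}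
    (hg1 : StrongConvexOn Set.univ μ g1) (hg2 : ConvexOn ℝ Set.univ g2)
    (hgrad : ∀ y, HasGradientAt g2 (g2' y) y)
    (hlip : ∀ x y, ‖g2' x - g2' y‖ ≤ L * ‖x - y‖)
    (hβ : 0 < β) (hγ : 0 < γ) (hu : 1 ≤ u)
    {ys y v ybar y' v' ζ : E} {lams lam lam' lambar : F}
    (hζ : ∀ z, g1 y' + ⟪ζ, z - y'⟫ ≤ g1 z)
    (hybar : v' - v = u • (y' - ybar))
    (hv' : v' = y' + (u - 1) • (y' - y))
    (hv : u • (v' - v) = -(β • (ζ + g2' ybar + ContinuousLinearMap.adjoint B lambar +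
        μ • (v' - y'))))
    (hlambar : lambar = lam + (γ * u) • B (v - ys))
    (hlam' : lam' = lam + (γ * u) • B (v' - ys)) :
    2 * β * u ^ 2 * (g1 y' + g2 y' - (g1 ys + g2 ys) + ⟪lams, B (y' - ys)⟫) +
        (u ^ 2 + β * μ * u) * ‖v' - ys‖ ^ 2 + β / γ * ‖lam' - lams‖ ^ 2 ≤
      2 * β * (u ^ 2 - u) * (g1 y + g2 y - (g1 ys + g2 ys) + ⟪lams, B (y - ys)⟫) +
        u ^ 2 * ‖v - ys‖ ^ 2 + β / γ * ‖lam - lams‖ ^ 2 - u ^ 2 * ‖v' - v‖ ^ 2 +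
        β * γ * u ^ 2 * (‖B (v' - v)‖ ^ 2 - ‖B (v - ys)‖ ^ 2) + β * L * ‖v' - v‖ ^ 2 -
        β * μ * (u - 1) * ‖v' - y‖ ^ 2 := by
  have H1 := composite_ineq hg1 hg2 hgrad hlip (ybar := ybar) hζ ys
  have H2 := composite_ineq hg1 hg2 hgrad hlip (ybar := ybar) hζ y
  obtain ⟨q, hq⟩ : ∃ q, q = ζ + g2' ybar := ⟨_, rfl⟩
  rw [← hq] at H1 H2 hv
  have e0 : ‖v' - v‖ ^ 2 = u ^ 2 * ‖y' - ybar‖ ^ 2 := by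
    rw [hybar, norm_smul, mul_pow, Real.norm_eq_abs, sq_abs]
  have e1 : u * ⟪v' - v, v' - ys⟫ =
      -(β * (⟪q, v' - ys⟫ + ⟪lambar, B (v' - ys)⟫ + μ * ⟪v' - y', v' - ys⟫)) := by
    have := congrArg (fun w => ⟪w, v' - ys⟫) hv
    simpa only [inner_smul_left, inner_neg_left, inner_add_left, RCLike.conj_to_real,
      ContinuousLinearMap.adjoint_inner_left] using this
  have f1 : v' - ys = (y' - ys) + (u - 1) • (y' - y) := by rw [hv']; abel
  have f2 : v' - y' = (u - 1) • (y' - y) := by rw [hv']; abel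
  have f3 : v' - y = u • (y' - y) := by
    rw [hv', sub_smul, one_smul]; abel
  have f4 : y - ys = (y' - ys) - (y' - y) := by abel
  have e2 : ⟪q, v' - ys⟫ = ⟪q, y' - ys⟫ + (u - 1) * ⟪q, y' - y⟫ := by
    rw [f1, inner_add_right, inner_smul_right]
  have e3 : ‖v - ys‖ ^ 2 = ‖v' - ys‖ ^ 2 - 2 * ⟪v' - v, v' - ys⟫ + ‖v' - v‖ ^ 2 := by
    have : v - ys = (v' - ys) - (v' - v) := by abel
    rw [this, norm_sub_sq_real, real_inner_comm]
  have e4 : 2 * ⟪v' - y', v' - ys⟫ = ‖v' - ys‖ ^ 2 + ‖v' - y'‖ ^ 2 - ‖ys - y'‖ ^ 2 := by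
    have h := norm_sub_sq_real (v' - y') (v' - ys)
    rw [sub_sub_sub_cancel_left] at h
    linarith
  have e5 : ‖v' - y'‖ ^ 2 = (u - 1) ^ 2 * ‖y - y'‖ ^ 2 := by
    rw [f2, norm_smul, mul_pow, Real.norm_eq_abs, sq_abs, norm_sub_rev]
  have e6 : ‖v' - y‖ ^ 2 = u ^ 2 * ‖y - y'‖ ^ 2 := by
    rw [f3, norm_smul, mul_pow, Real.norm_eq_abs, sq_abs, norm_sub_rev]
  have e7 : ⟪lams, B (v' - ys)⟫ = u * ⟪lams, B (y' - ys)⟫ - (u - 1) * ⟪lams, B (y - ys)⟫ := by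
    rw [f4, f1]
    simp only [map_add, map_sub, map_smul, inner_add_right, inner_sub_right, inner_smul_right]
    ring
  have e8 : ‖lam' - lams‖ ^ 2 = ‖lam - lams‖ ^ 2 + 2 * (γ * u) * ⟪lam - lams, B (v' - ys)⟫ +
      (γ * u) ^ 2 * ‖B (v' - ys)‖ ^ 2 := by
    have : lam' - lams = (lam - lams) + (γ * u) • B (v' - ys) := by rw [hlam']; abel
    rw [this, norm_add_sq_real, inner_smul_right, norm_smul, mul_pow, Real.norm_eq_abs, sq_abs]
    ring
  have e9 : ⟪lambar, B (v' - ys)⟫ = ⟪lams, B (v' - ys)⟫ + ⟪lam - lams, B (v' - ys)⟫ +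
      γ * u * ⟪B (v - ys), B (v' - ys)⟫ := by
    rw [hlambar, inner_add_left, inner_smul_left, inner_sub_left]
    simp
  have e10 : ‖B (v' - v)‖ ^ 2 =
      ‖B (v' - ys)‖ ^ 2 - 2 * ⟪B (v - ys), B (v' - ys)⟫ + ‖B (v - ys)‖ ^ 2 := by
    have : B (v' - v) = B (v' - ys) - B (v - ys) := by rw [← map_sub]; congr 1; abel
    rw [this, norm_sub_sq_real, real_inner_comm]
  have e8' : β / γ * ‖lam' - lams‖ ^ 2 = β / γ * ‖lam - lams‖ ^ 2 +
      2 * β * u * ⟪lam - lams, B (v' - ys)⟫ + β * γ * u ^ 2 * ‖B (v' - ys)‖ ^ 2 := by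
    rw [e8]; field_simp
  rw [e8', e3, e10, e6]
  rw [e7] at e9
  have k1 := mul_le_mul_of_nonneg_left H1 (by positivity : 0 ≤ 2 * β * u)
  have k2 := mul_le_mul_of_nonneg_left H2
    (mul_nonneg (by positivity) (by linarith) : 0 ≤ 2 * β * u * (u - 1))
  linear_combination k1 + k2 + 2 * u * e1 - 2 * β * u * e2 - β * L * e0 -
    2 * β * u * e9 - β * μ * u * e4 - β * μ * u * e5
end

section
variable {E F : Type*} [NormedAddCommGroup E] [InnerProductSpace ℝ E]
  [NormedAddCommGroup F] [InnerProductSpace ℝ F]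

/-- The bilinear form `⟪x, z⟫ - c ⟪B x, B z⟫`. -/
noncomputable def defectForm (B : E →L[ℝ] F) (c : ℝ) (x z : E) : ℝ :=
  ⟪x, z⟫ - c * ⟪B x, B z⟫

theorem defectForm_self (B : E →L[ℝ] F) (c : ℝ) (x : E) :
    defectForm B c x x = ‖x‖ ^ 2 - c * ‖B x‖ ^ 2 := by
  simp [defectForm]

theorem defectForm_comb (B : E →L[ℝ] F) (c a₁ a₂ : ℝ) (x z : E) :
    defectForm B c (a₁ • x + a₂ • z) (a₁ • x + a₂ • z) =
      a₁ ^ 2 * defectForm B c x x + 2 * a₁ * a₂ * defectForm B c x z +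
        a₂ ^ 2 * defectForm B c z z := by
  simp only [defectForm, map_add, map_smul, inner_add_left, inner_add_right, real_inner_smul_left,
    real_inner_smul_right]
  rw [real_inner_comm x z, real_inner_comm (B x) (B z)]
  ring

variable {B : E →L[ℝ] F} {c : ℝ}

theorem defectForm_add (x z : E) :
    defectForm B c (x + z) (x + z) =
      defectForm B c x x + 2 * defectForm B c x z + defectForm B c z z := by
  simpa using defectForm_comb B c 1 1 x z

theorem defectForm_sub (x z : E) :
    defectForm B c (x - z) (x - z) =
      defectForm B c x x - 2 * defectForm B c x z + defectForm B c z z := by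
  simpa [sub_eq_add_neg] using defectForm_comb B c 1 (-1) x z

theorem defectForm_quadratic_nonneg (hQ : ∀ z, 0 ≤ defectForm B c z z) {N A : ℝ} (hN : 0 ≤ N)
    (hAN : 1 ≤ A * N) (x z : E) :
    0 ≤ N * defectForm B c x x + 2 * defectForm B c x z + A * defectForm B c z z := by
  have hN' : 0 < N := hN.lt_of_ne (by rintro rfl; linarith)
  have h := hQ (N • x + (1 : ℝ) • z)
  rw [defectForm_comb] at h
  have h2 := mul_nonneg (sub_nonneg.2 hAN) (hQ z)
  refine nonneg_of_mul_nonneg_right (a := N) ?_ hN'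
  linarith

theorem defectForm_harmonic (hQ : ∀ z, 0 ≤ defectForm B c z z) {w h : ℝ} (hwh : 0 < w + h)
    (x z : E) :
    w * h / (w + h) * defectForm B c z z ≤
      h * defectForm B c x x + w * defectForm B c (z - x) (z - x) := by
  have h1 := hQ (w • z + (-(w + h)) • x)
  rw [defectForm_comb] at h1
  rw [defectForm_sub, div_mul_eq_mul_div, div_le_iff₀ hwh]
  linarith

theorem coupling_form (hQ : ∀ z, 0 ≤ defectForm B c z z) {σ T u ρ : ℝ} (hσ : 0 ≤ σ)
    (hσ2 : σ ^ 2 ≤ 1 + σ) (hT : 1 + σ ≤ T ^ 2) (hT0 : 0 < T) (hTu : T ≤ u)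
    (hu : u ^ 2 ≤ T ^ 2 + u) (hρ : σ + (u ^ 2 - T ^ 2) ≤ ρ) (Y D D' : E) :
    0 ≤ σ * ((2 * u - (u ^ 2 - T ^ 2) - T) * defectForm B c Y Y + 2 * defectForm B c Y D' +
      (1 - σ * (1 - 1 / u) ^ 2) * defectForm B c D' D' + (T + σ) * defectForm B c D D) +
      ρ * defectForm B c (D' - D) (D' - D) := by
  have hr : 0 ≤ u ^ 2 - T ^ 2 := by nlinarith
  rcases hσ.eq_or_lt with rfl | hσ
  · have := mul_nonneg (by linarith : 0 ≤ ρ) (hQ (D' - D))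
    linarith
  have hw : 0 < 1 + (u ^ 2 - T ^ 2) / σ := by positivity
  have h1 := defectForm_quadratic_nonneg hQ (by linarith) (coupling hσ hσ2 hT hT0 hTu hu) Y D'
  have h2 := defectForm_harmonic hQ (by positivity :
    0 < 1 + (u ^ 2 - T ^ 2) / σ + (T + σ)) D D'
  have h3 := mul_le_mul_of_nonneg_right hρ (hQ (D' - D))
  have h4 : σ + (u ^ 2 - T ^ 2) = σ * (1 + (u ^ 2 - T ^ 2) / σ) := by field_simp
  rw [h4] at h3
  have h5 := mul_nonneg hσ.le (add_nonneg h1 (sub_nonneg.2 h2))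
  linarith

theorem coupling_form_init (hQ : ∀ z, 0 ≤ defectForm B c z z) {τ σ s : ℝ} (hτ : 1 ≤ τ)
    (hσ : 0 ≤ σ) (hs : s ^ 2 = τ ^ 2 + σ * τ) (hs0 : 0 < s) (hσs : σ * τ ≤ s) (Y D' : E) :
    0 ≤ σ * ((2 * s - (s ^ 2 - τ ^ 2) - τ) * defectForm B c Y Y + 2 * defectForm B c Y D' +
      (1 - σ * (1 - 1 / s) ^ 2) * defectForm B c D' D') +
      (s ^ 2 - τ ^ 2) * defectForm B c D' D' := by
  rcases hσ.eq_or_lt with rfl | hσ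
  · simp [hs]
  have hτs : τ ≤ s := by nlinarith [mul_pos hσ (by linarith : 0 < τ)]
  have h1 := defectForm_quadratic_nonneg hQ (by linarith) (coupling_init hτ hσ hs hs0 hσs) Y D'
  have h2 := mul_nonneg hσ.le h1
  have h3 : s ^ 2 - τ ^ 2 = σ * τ := by linarith
  rw [h3] at h2 ⊢
  linarith

theorem invariant_step (hc : 0 ≤ c) {σ m T u τ G Λ R Z : ℝ} {Y D D' : E} (hσ : 0 ≤ σ)
    (hσm : σ ≤ m) (hu1 : 1 ≤ u) (hu : u ^ 2 ≤ T ^ 2 + u) (hG : m * ‖Y‖ ^ 2 ≤ G)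
    (hcpl : 0 ≤ σ * ((2 * u - (u ^ 2 - T ^ 2) - T) * defectForm B c Y Y +
      2 * defectForm B c Y D' + (1 - σ * (1 - 1 / u) ^ 2) * defectForm B c D' D' +
      (T + σ) * defectForm B c D D) +
      (u ^ 2 - τ ^ 2) * defectForm B c (D' - D) (D' - D))
    (hP : T ^ 2 * G + u ^ 2 * ‖Y + D‖ ^ 2 + Λ -
      (u ^ 2 - τ ^ 2) * (‖Y + D‖ ^ 2 - defectForm B c (Y + D) (Y + D)) ≤
      R + σ * (T * defectForm B c Y Y - (T + σ) * defectForm B c D D))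
    (hE : Z ≤ (u ^ 2 - u) * G + u ^ 2 * ‖Y + D‖ ^ 2 + Λ -
      (u ^ 2 - τ ^ 2) * (defectForm B c (D' - D) (D' - D) +
        (‖Y + D‖ ^ 2 - defectForm B c (Y + D) (Y + D))) - m * (u - 1) * ‖D'‖ ^ 2) :
    Z ≤ R + σ * (u * defectForm B c (Y + (1 / u) • D') (Y + (1 / u) • D') -
      (u + σ) * defectForm B c ((1 - 1 / u) • D') ((1 - 1 / u) • D')) := by
  have hu0 : 0 < u := by linarith
  have hle : ∀ z, defectForm B c z z ≤ ‖z‖ ^ 2 := fun z => by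
    rw [defectForm_self]
    have := mul_nonneg hc (sq_nonneg ‖B z‖)
    linarith
  have q : ∀ z, σ * defectForm B c z z ≤ m * ‖z‖ ^ 2 := fun z =>
    (mul_le_mul_of_nonneg_left (hle z) hσ).trans (mul_le_mul_of_nonneg_right hσm (sq_nonneg _))
  have h1 := mul_le_mul_of_nonneg_left ((q Y).trans hG) (sub_nonneg.2 hu)
  have h2 := mul_le_mul_of_nonneg_left (q D') (sub_nonneg.2 hu1)
  have e1 := defectForm_comb B c 1 (1 / u) Y D'
  have e2 := defectForm_comb B c 0 (1 - 1 / u) Y D'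
  simp only [one_smul, zero_smul, zero_add] at e1 e2
  have e : σ * (u * defectForm B c (Y + (1 / u) • D') (Y + (1 / u) • D') -
      (u + σ) * defectForm B c ((1 - 1 / u) • D') ((1 - 1 / u) • D')) =
      σ * (u * defectForm B c Y Y + 2 * defectForm B c Y D' +
        (2 - u - σ * (1 - 1 / u) ^ 2) * defectForm B c D' D') := by
    rw [e1, e2]; field_simp; ring
  rw [e]
  linarith

theorem invariant_bound (hc : 0 ≤ c) (hQ : ∀ z, 0 ≤ defectForm B c z z) {σ m T G Λ R : ℝ}
    {Y D : E} (hσ : 0 ≤ σ) (hσm : σ ≤ m) (hT : 0 ≤ T)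
    (hZ : G + (T ^ 2 + m * T) * ‖Y + D‖ ^ 2 + Λ ≤
      R + σ * (T * defectForm B c Y Y - (T + σ) * defectForm B c D D)) :
    G + Λ ≤ R := by
  have h1 := hQ (T • Y + (T + σ) • D)
  rw [defectForm_comb] at h1
  have h2 : T * (T + σ) * defectForm B c (Y + D) (Y + D) ≤ (T ^ 2 + m * T) * ‖Y + D‖ ^ 2 := by
    refine mul_le_mul ?_ ?_ (hQ _) (by nlinarith)
    · nlinarith
    · rw [defectForm_self]
      have := mul_nonneg hc (sq_nonneg ‖B (Y + D)‖)
      linarith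
  rw [defectForm_add] at h2
  linarith

theorem defectForm_bounds {L β γ τ : ℝ} (hL : 0 ≤ L) (hγ : 0 ≤ γ) (hβ : 0 < β)
    (hτ : 0 < τ) (h : β ≤ τ ^ 2 / (L + τ ^ 2 * γ * ‖B‖ ^ 2)) (z : E) :
    0 ≤ defectForm B (β * γ) z z ∧
      β * L * ‖z‖ ^ 2 ≤ τ ^ 2 * defectForm B (β * γ) z z := by
  have hden : 0 < L + τ ^ 2 * γ * ‖B‖ ^ 2 := by
    refine (by positivity : 0 ≤ L + τ ^ 2 * γ * ‖B‖ ^ 2).lt_of_ne fun h0 => ?_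
    rw [← h0, div_zero] at h
    linarith
  rw [le_div_iff₀ hden] at h
  have h1 : ‖B z‖ ^ 2 ≤ ‖B‖ ^ 2 * ‖z‖ ^ 2 := by
    rw [← mul_pow]
    exact pow_le_pow_left₀ (norm_nonneg _) (B.le_opNorm z) 2
  have h2 := mul_le_mul_of_nonneg_left h1 (by positivity : 0 ≤ β * τ ^ 2 * γ)
  have h3 := mul_le_mul_of_nonneg_right h (sq_nonneg ‖z‖)
  have key : β * L * ‖z‖ ^ 2 ≤ τ ^ 2 * defectForm B (β * γ) z z := by
    rw [defectForm_self]
    linarith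
  exact ⟨nonneg_of_mul_nonneg_right ((by positivity : 0 ≤ β * L * ‖z‖ ^ 2).trans key)
    (by positivity), key⟩

/-- `t k ^ 2 • r k` stays bounded: `S k - t k ^ 2 • r k` is a convex combination of earlier terms. -/
theorem feasibility_bound {t : ℕ → ℝ} (ht1 : ∀ k ≥ 1, 1 ≤ t k)
    (htrec : ∀ k ≥ 1, t (k + 1) ^ 2 ≤ t k ^ 2 + t (k + 1)) {r S : ℕ → F} {M : ℝ}
    (hS1 : S 1 = t 1 ^ 2 • r 1)
    (hS : ∀ k ≥ 1, S (k + 1) =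
      S k + t (k + 1) ^ 2 • r (k + 1) - (t (k + 1) ^ 2 - t (k + 1)) • r k)
    (hM : ∀ k ≥ 1, ‖S k‖ ≤ M) (k : ℕ) (hk : 1 ≤ k) :
    t k ^ 2 * ‖r k‖ ≤ 2 * M := by
  have hw : ‖S k - t k ^ 2 • r k‖ ≤ M := by
    induction k, hk using Nat.le_induction with
    | base => simpa [hS1] using (norm_nonneg _).trans (hM 1 le_rfl)
    | succ k hk ih =>
      have hT : 0 < t k ^ 2 := by have := ht1 k hk; positivity
      have hu := ht1 (k + 1) (by omega)
      obtain ⟨c, hc⟩ : ∃ c, c = (t (k + 1) ^ 2 - t (k + 1)) / t k ^ 2 := ⟨_, rfl⟩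
      have hc0 : 0 ≤ c := by rw [hc]; exact div_nonneg (by nlinarith) hT.le
      have hc1 : 0 ≤ 1 - c := by
        rw [hc, sub_nonneg, div_le_one hT]; linarith [htrec k hk]
      have e : c * t k ^ 2 = t (k + 1) ^ 2 - t (k + 1) := by
        rw [hc, div_mul_cancel₀ _ hT.ne']
      have : S (k + 1) - t (k + 1) ^ 2 • r (k + 1) =
          (1 - c) • S k + c • (S k - t k ^ 2 • r k) := by
        rw [hS k hk, smul_sub c, smul_smul, e]; module
      rw [this]
      refine (norm_add_le _ _).trans ?_
      rw [norm_smul, norm_smul, Real.norm_of_nonneg hc0, Real.norm_of_nonneg hc1]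
      have := mul_le_mul_of_nonneg_left (hM k hk) hc1
      have := mul_le_mul_of_nonneg_left ih hc0
      linarith
  have h := norm_sub_le (S k) (S k - t k ^ 2 • r k)
  rw [sub_sub_cancel, norm_smul, Real.norm_of_nonneg (sq_nonneg _)] at h
  linarith [hM k hk]
end

section
variable {E F : Type*} [NormedAddCommGroup E] [InnerProductSpace ℝ E] [CompleteSpace E]
  [NormedAddCommGroup F] [InnerProductSpace ℝ F] [CompleteSpace F]

theorem lagrangian_gap_lower {B : E →L[ℝ] F} {g1 g2 : E → ℝ} {μ : ℝ}
    (hg1 : StrongConvexOn Set.univ μ g1) (hg2 : ConvexOn ℝ Set.univ g2) {ys : E} {lams : F}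
    (hmin : ∀ z, g1 ys + g2 ys ≤ g1 z + g2 z + ⟪lams, B (z - ys)⟫) (z : E) :
    μ / 2 * ‖z - ys‖ ^ 2 ≤ g1 z + g2 z - (g1 ys + g2 ys) + ⟪lams, B (z - ys)⟫ := by
  have hsc : StrongConvexOn Set.univ μ (fun z => g1 z + g2 z) := by
    refine ⟨convex_univ, fun x _ y _ a b ha hb hab => ?_⟩
    have h1 := hg1.2 (Set.mem_univ x) (Set.mem_univ y) ha hb hab
    have h2 := hg2.2 (Set.mem_univ x) (Set.mem_univ y) ha hb hab
    simp only [smul_eq_mul] at h1 h2 ⊢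
    linarith
  have h := (hsc.add_inner (ContinuousLinearMap.adjoint B lams)
    (-⟪lams, B ys⟫)).add_sq_norm_sub_le_of_isMin (x := ys) (fun z => by
      have := hmin z
      simp only [ContinuousLinearMap.adjoint_inner_left, map_sub, inner_sub_right] at this ⊢
      linarith) z
  simp only [ContinuousLinearMap.adjoint_inner_left, map_sub, inner_sub_right] at h ⊢
  linarith

theorem energy_bound {B : E →L[ℝ] F} {g1 g2 : E → ℝ} {g2' : E → E} {L μ β γ : ℝ}
    (hL : 0 ≤ L)
    (hg1 : StrongConvexOn Set.univ μ g1) (hg2 : ConvexOn ℝ Set.univ g2)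
    (hgrad : ∀ y, HasGradientAt g2 (g2' y) y)
    (hlip : ∀ x y, ‖g2' x - g2' y‖ ≤ L * ‖x - y‖)
    (hβ : 0 < β) (hγ : 0 < γ)
    {t : ℕ → ℝ} (ht1 : ∀ k ≥ 1, 1 ≤ t k) (htmono : ∀ k ≥ 1, t k ≤ t (k + 1))
    (hβle : β ≤ t 1 ^ 2 / (L + t 1 ^ 2 * γ * ‖B‖ ^ 2))
    (htrec : ∀ k ≥ 1, t (k + 1) ^ 2 ≤ t k ^ 2 + t (k + 1))
    (htrec2 : ∀ k ≥ 1, t (k + 1) ^ 2 ≤ t k ^ 2 + β * μ * t k)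
    {y v ybar ζ : ℕ → E} {lam lambar : ℕ → F} {ys : E} {lams : F}
    (hv1 : v 1 = y 1)
    (hybar : ∀ k ≥ 1, v (k + 1) - v k = t (k + 1) • (y (k + 1) - ybar k))
    (hlambar : ∀ k ≥ 1, lambar (k + 1) = lam k + (γ * t (k + 1)) • B (v k - ys))
    (hζ : ∀ k ≥ 1, ∀ z, g1 (y (k + 1)) + ⟪ζ (k + 1), z - y (k + 1)⟫ ≤ g1 z)
    (hv : ∀ k ≥ 1, t (k + 1) • (v (k + 1) - v k) =
      -(β • (ζ (k + 1) + g2' (ybar k) + ContinuousLinearMap.adjoint B (lambar (k + 1)) +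
        μ • (v (k + 1) - y (k + 1)))))
    (hvupd : ∀ k ≥ 1, v (k + 1) = y (k + 1) + (t (k + 1) - 1) • (y (k + 1) - y k))
    (hlam : ∀ k ≥ 1, lam (k + 1) = lam k + (γ * t (k + 1)) • B (v (k + 1) - ys))
    {G : ℕ → ℝ}
    (hGdef : ∀ k, G k = g1 (y k) + g2 (y k) - (g1 ys + g2 ys) + ⟪lams, B (y k - ys)⟫)
    (hG : ∀ k, μ / 2 * ‖y k - ys‖ ^ 2 ≤ G k) (k : ℕ) (hk : 1 ≤ k) :
    t k ^ 2 * G k + 1 / (2 * γ) * ‖lam k - lams‖ ^ 2 ≤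
      t 1 ^ 2 * G 1 + t 1 ^ 2 / (2 * β) * ‖y 1 - ys‖ ^ 2 + 1 / (2 * γ) * ‖lam 1 - lams‖ ^ 2 := by
  have ht1' := ht1 1 le_rfl
  have ht0 : 0 < t 1 := by linarith
  have hc : 0 ≤ β * γ := by positivity
  have hQ := fun z => (defectForm_bounds (B := B) hL hγ.le hβ ht0 hβle z).1
  have hQL := fun z => (defectForm_bounds (B := B) hL hγ.le hβ ht0 hβle z).2
  have hw : ∀ z, 0 ≤ ‖z‖ ^ 2 - defectForm B (β * γ) z z := fun z => by
    rw [defectForm_self]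
    have := mul_nonneg hc (sq_nonneg ‖B z‖)
    linarith
  obtain ⟨R, hR⟩ : ∃ R, R = 2 * β * t 1 ^ 2 * G 1 + t 1 ^ 2 * ‖y 1 - ys‖ ^ 2 +
    β / γ * ‖lam 1 - lams‖ ^ 2 := ⟨_, rfl⟩
  have hmono : ∀ j k, 1 ≤ j → j ≤ k → t j ≤ t k := fun j k hj hjk => by
    induction k, hjk using Nat.le_induction with
    | base => exact le_rfl
    | succ k hk ih => exact ih.trans (htmono k (hj.trans hk))
  have hs := ht1 2 one_le_two
  have htm1 : t 1 ≤ t 2 := htmono 1 le_rfl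
  obtain ⟨σ, hσ⟩ : ∃ σ, σ = (t 2 ^ 2 - t 1 ^ 2) / t 1 := ⟨_, rfl⟩
  have hσ0 : 0 ≤ σ := by
    rw [hσ]; exact div_nonneg (by nlinarith) ht0.le
  have hσt : t 2 ^ 2 = t 1 ^ 2 + σ * t 1 := by rw [hσ]; field_simp; ring
  have hσs : σ * t 1 ≤ t 2 := by have : t 2 ^ 2 ≤ _ := htrec 1 le_rfl; linarith
  have hσm : σ ≤ β * μ := by
    have : t 2 ^ 2 ≤ _ := htrec2 1 le_rfl
    exact le_of_mul_le_mul_right (by linarith) ht0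
  have hσ2 : σ ^ 2 ≤ 1 + σ := by
    have h1 : (σ * t 1) ^ 2 ≤ t 2 ^ 2 := pow_le_pow_left₀ (by positivity) hσs 2
    have h2 : σ * t 1 ≤ σ * t 1 ^ 2 := by gcongr; nlinarith
    refine le_of_mul_le_mul_right (a := t 1 ^ 2) ?_ (by positivity)
    linarith
  have step : ∀ k ≥ 1,
      0 ≤ σ * ((2 * t (k + 1) - (t (k + 1) ^ 2 - t k ^ 2) - t k) *
        defectForm B (β * γ) (y k - ys) (y k - ys) +
        2 * defectForm B (β * γ) (y k - ys) (v (k + 1) - y k) +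
        (1 - σ * (1 - 1 / t (k + 1)) ^ 2) *
          defectForm B (β * γ) (v (k + 1) - y k) (v (k + 1) - y k) +
        (t k + σ) * defectForm B (β * γ) (v k - y k) (v k - y k)) +
        (t (k + 1) ^ 2 - t 1 ^ 2) * defectForm B (β * γ) (v (k + 1) - y k - (v k - y k))
          (v (k + 1) - y k - (v k - y k)) →
      t k ^ 2 * (2 * β * G k) + t (k + 1) ^ 2 * ‖v k - ys‖ ^ 2 +
        β / γ * ‖lam k - lams‖ ^ 2 - (t (k + 1) ^ 2 - t 1 ^ 2) *
          (‖v k - ys‖ ^ 2 - defectForm B (β * γ) (v k - ys) (v k - ys)) ≤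
        R + σ * (t k * defectForm B (β * γ) (y k - ys) (y k - ys) -
          (t k + σ) * defectForm B (β * γ) (v k - y k) (v k - y k)) →
      t (k + 1) ^ 2 * (2 * β * G (k + 1)) +
        (t (k + 1) ^ 2 + β * μ * t (k + 1)) * ‖v (k + 1) - ys‖ ^ 2 +
        β / γ * ‖lam (k + 1) - lams‖ ^ 2 ≤
        R + σ * (t (k + 1) * defectForm B (β * γ) (y (k + 1) - ys) (y (k + 1) - ys) -
          (t (k + 1) + σ) *
            defectForm B (β * γ) (v (k + 1) - y (k + 1)) (v (k + 1) - y (k + 1))) := by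
    intro k hk hcpl hP
    have hu1 := ht1 (k + 1) (by omega)
    have hu0 : t (k + 1) ≠ 0 := by positivity
    have hE := energy_step (lams := lams) hg1 hg2 hgrad hlip hβ hγ hu1 (hζ k hk) (hybar k hk)
      (hvupd k hk) (hv k hk) (hlambar k hk) (hlam k hk)
    rw [← hGdef, ← hGdef] at hE
    have a1 : y k - ys + (v k - y k) = v k - ys := by abel
    have a2 : v (k + 1) - y k - (v k - y k) = v (k + 1) - v k := by abel
    have a3 : v (k + 1) - y k = t (k + 1) • (y (k + 1) - y k) := by
      rw [hvupd k hk, sub_smul, one_smul]; abel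
    have a4 : y k - ys + (1 / t (k + 1)) • (v (k + 1) - y k) = y (k + 1) - ys := by
      rw [a3, smul_smul, one_div_mul_cancel hu0, one_smul]; abel
    have a5 : (1 - 1 / t (k + 1)) • (v (k + 1) - y k) = v (k + 1) - y (k + 1) := by
      rw [sub_smul, one_smul]
      nth_rewrite 2 [a3]
      rw [smul_smul, one_div_mul_cancel hu0, one_smul]; abel
    have h1 := hQL (v (k + 1) - v k)
    have h2 := mul_nonneg (sq_nonneg (t 1)) (hw (v k - ys))
    have h3 := defectForm_self B (β * γ) (v (k + 1) - v k)
    have h4 := defectForm_self B (β * γ) (v k - ys)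
    have h5 : t (k + 1) ^ 2 * defectForm B (β * γ) (v (k + 1) - v k) (v (k + 1) - v k) =
      t (k + 1) ^ 2 * (‖v (k + 1) - v k‖ ^ 2 - β * γ * ‖B (v (k + 1) - v k)‖ ^ 2) := by rw [h3]
    have h6 : t (k + 1) ^ 2 * defectForm B (β * γ) (v k - ys) (v k - ys) =
      t (k + 1) ^ 2 * (‖v k - ys‖ ^ 2 - β * γ * ‖B (v k - ys)‖ ^ 2) := by rw [h4]
    have h := invariant_step (B := B) (m := β * μ) (G := 2 * β * G k) (τ := t 1)
      (Λ := β / γ * ‖lam k - lams‖ ^ 2) (R := R) (D := v k - y k) hc hσ0 hσm hu1 (htrec k hk)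
      (by have := mul_le_mul_of_nonneg_left (hG k) (by positivity : 0 ≤ 2 * β); linarith)
      hcpl (by rw [a1]; exact hP)
      (Z := t (k + 1) ^ 2 * (2 * β * G (k + 1)) +
        (t (k + 1) ^ 2 + β * μ * t (k + 1)) * ‖v (k + 1) - ys‖ ^ 2 +
        β / γ * ‖lam (k + 1) - lams‖ ^ 2) (by
          rw [a1, a2]
          linarith)
    rwa [a4, a5] at h
  have inv : ∀ k ≥ 2, t k ^ 2 * (2 * β * G k) +
        (t k ^ 2 + β * μ * t k) * ‖v k - ys‖ ^ 2 + β / γ * ‖lam k - lams‖ ^ 2 ≤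
        R + σ * (t k * defectForm B (β * γ) (y k - ys) (y k - ys) -
          (t k + σ) * defectForm B (β * γ) (v k - y k) (v k - y k)) := by
    intro k hk
    induction k, hk using Nat.le_induction with
    | base =>
      refine step 1 le_rfl ?_ ?_
      · have h := coupling_form_init (B := B) (c := β * γ) hQ ht1' hσ0 hσt (by linarith) hσs
          (y 1 - ys) (v 2 - y 1)
        simpa [hv1, defectForm] using h
      · have h : (t 2 ^ 2 - t 1 ^ 2) * defectForm B (β * γ) (y 1 - ys) (y 1 - ys) =
            σ * t 1 * defectForm B (β * γ) (y 1 - ys) (y 1 - ys) := by rw [hσt]; ring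
        have h0 : defectForm B (β * γ) (0 : E) 0 = 0 := by simp [defectForm]
        rw [hv1, sub_self, h0, hR]
        change _ + t 2 ^ 2 * _ + _ - (t 2 ^ 2 - t 1 ^ 2) * _ ≤ _
        linarith
    | succ k hk ih =>
      have hk1 : 1 ≤ k := by omega
      have hTs : t 2 ≤ t k := hmono 2 k one_le_two hk
      have hsq : t 2 ^ 2 ≤ t k ^ 2 := pow_le_pow_left₀ (by linarith) hTs 2
      have huT := htmono k hk1
      have h1 : σ ≤ σ * t 1 := le_mul_of_one_le_right hσ0 ht1'
      have h2 : 1 ≤ t 1 ^ 2 := one_le_pow₀ ht1'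
      have husq : t k ^ 2 ≤ t (k + 1) ^ 2 := pow_le_pow_left₀ (by linarith) huT 2
      refine step k hk1 ?_ ?_
      · exact coupling_form hQ hσ0 hσ2 (by linarith) (by linarith) huT (htrec k hk1)
          (by linarith) _ _ _
      · refine le_trans ?_ ih
        have h3 := mul_nonneg (by linarith : 0 ≤ t (k + 1) ^ 2 - t 1 ^ 2) (hw (v k - ys))
        have h4 := mul_le_mul_of_nonneg_right (htrec2 k hk1) (sq_nonneg ‖v k - ys‖)
        linarith
  have hβ2 : 0 < 2 * β := by positivity
  have eR : t 1 ^ 2 * G 1 + t 1 ^ 2 / (2 * β) * ‖y 1 - ys‖ ^ 2 +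
      1 / (2 * γ) * ‖lam 1 - lams‖ ^ 2 = R / (2 * β) := by
    rw [hR]; field_simp
  rw [eR, le_div_iff₀ hβ2]
  have eL : (t k ^ 2 * G k + 1 / (2 * γ) * ‖lam k - lams‖ ^ 2) * (2 * β) =
      t k ^ 2 * (2 * β * G k) + β / γ * ‖lam k - lams‖ ^ 2 := by
    field_simp
  rw [eL]
  rcases hk.eq_or_lt with rfl | hk2
  · have : 0 ≤ t 1 ^ 2 * ‖y 1 - ys‖ ^ 2 := by positivity
    rw [hR]
    linarith
  · have h := inv k hk2
    have a1 : v k - ys = y k - ys + (v k - y k) := by abel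
    rw [a1] at h
    exact invariant_bound hc hQ hσ0 hσm (by have := ht1 k hk; linarith) h
end

/-- Accelerated linearized ALM based on Nesterov's second scheme (Algorithm 8),
strongly convex case (Theorem 3.5): convergence rates for the one-block linearly
constrained problem `min g1 + g2 s.t. By = b`. -/
theorem stmt16 {n p : ℕ}
    (B : EuclideanSpace ℝ (Fin n) →L[ℝ] EuclideanSpace ℝ (Fin p))
    (b : EuclideanSpace ℝ (Fin p))
    (g1 g2 : EuclideanSpace ℝ (Fin n) → ℝ)
    (g2' : EuclideanSpace ℝ (Fin n) → EuclideanSpace ℝ (Fin n))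
    (Lg2 μ : ℝ) (hLg2 : 0 ≤ Lg2) (hμ : 0 < μ)
    (hg1lsc : LowerSemicontinuous g1) (hg1sc : StrongConvexOn Set.univ μ g1)
    (hg2conv : ConvexOn ℝ Set.univ g2)
    (hg2grad : ∀ y, HasGradientAt g2 (g2' y) y)
    (hg2lip : ∀ x y, ‖g2' x - g2' y‖ ≤ Lg2 * ‖x - y‖)
    (β γ : ℝ) (hβ : 0 < β) (hγ : 0 < γ)
    (t : ℕ → ℝ) (ht1 : ∀ k ≥ 1, 1 ≤ t k) (htmono : ∀ k ≥ 1, t k ≤ t (k + 1))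
    (hβle : β ≤ t 1 ^ 2 / (Lg2 + t 1 ^ 2 * γ * ‖B‖ ^ 2))
    (htrec : ∀ k ≥ 1, t (k + 1) ^ 2 ≤ t k ^ 2 + t (k + 1))
    (htrec2 : ∀ k ≥ 1, t (k + 1) ^ 2 ≤ t k ^ 2 + β * μ * t k)
    (y v ybar : ℕ → EuclideanSpace ℝ (Fin n))
    (lam lambar : ℕ → EuclideanSpace ℝ (Fin p))
    (ζ : ℕ → EuclideanSpace ℝ (Fin n))
    (hy0 : y 0 = y 1) (hv1 : v 1 = y 1)
    (hybar : ∀ k ≥ 1, ybar k = y k + ((t k - 1) / t (k + 1)) • (y k - y (k - 1)))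
    (hlambar : ∀ k ≥ 1, lambar (k + 1) = lam k + (γ * t (k + 1)) • (B (v k) - b))
    (hζ : ∀ k ≥ 1, ∀ z, g1 (y (k + 1)) + ⟪ζ (k + 1), z - y (k + 1)⟫ ≤ g1 z)
    (hv : ∀ k ≥ 1, v (k + 1) - v k =
      -((β / t (k + 1)) • (ζ (k + 1) + g2' (ybar k) +
        ContinuousLinearMap.adjoint B (lambar (k + 1)) +
        μ • (v (k + 1) - y (k + 1)))))
    (hvupd : ∀ k ≥ 1, v (k + 1) = y (k + 1) + (t (k + 1) - 1) • (y (k + 1) - y k))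
    (hlam : ∀ k ≥ 1, lam (k + 1) = lam k + (γ * t (k + 1)) • (B (v (k + 1)) - b))
    -- saddle point of the Lagrangian `𝓛(y,λ) = g1 y + g2 y + ⟪λ, B y − b⟫`
    (ys : EuclideanSpace ℝ (Fin n)) (lams : EuclideanSpace ℝ (Fin p))
    (hsaddle : ∀ (yy : EuclideanSpace ℝ (Fin n)) (ll : EuclideanSpace ℝ (Fin p)),
      g1 ys + g2 ys + ⟪ll, B ys - b⟫ ≤ g1 ys + g2 ys + ⟪lams, B ys - b⟫ ∧
      g1 ys + g2 ys + ⟪lams, B ys - b⟫ ≤ g1 yy + g2 yy + ⟪lams, B yy - b⟫) :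
    let E1 : ℝ :=
      t 1 ^ 2 * (g1 (y 1) + g2 (y 1) - (g1 ys + g2 ys) + ⟪lams, B (y 1) - b⟫) +
      t 1 ^ 2 / (2 * β) * ‖y 1 - ys‖ ^ 2 + 1 / (2 * γ) * ‖lam 1 - lams‖ ^ 2
    let C4 : ℝ :=
      3 * t 1 ^ 2 * ‖B (y 1) - b‖ +
        (2 * ‖lam 1 - lams‖ + 2 * Real.sqrt (2 * γ * E1)) / γ
    ∀ k ≥ 1,
      ‖B (y k) - b‖ ≤ C4 / t k ^ 2 ∧
      |g1 (y k) + g2 (y k) - (g1 ys + g2 ys)| ≤ (E1 + C4 * ‖lams‖) / t k ^ 2 := by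
  intro E1 C4
  have hBys : b = B ys := by
    have h := (hsaddle ys (lams + (B ys - b))).1
    rw [inner_add_left, real_inner_self_eq_norm_sq] at h
    have h0 : ‖B ys - b‖ ^ 2 = 0 := le_antisymm (by linarith) (sq_nonneg _)
    exact (sub_eq_zero.1 (norm_eq_zero.1 (pow_eq_zero_iff two_ne_zero |>.1 h0))).symm
  subst hBys
  simp only [← map_sub] at hlambar hlam hsaddle
  have hmin : ∀ z, g1 ys + g2 ys ≤ g1 z + g2 z + ⟪lams, B (z - ys)⟫ := fun z => by
    simpa using (hsaddle z lams).2
  obtain ⟨G, hGdef⟩ : ∃ G : ℕ → ℝ, ∀ k,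
    G k = g1 (y k) + g2 (y k) - (g1 ys + g2 ys) + ⟪lams, B (y k - ys)⟫ := ⟨_, fun _ => rfl⟩
  have hG : ∀ k, μ / 2 * ‖y k - ys‖ ^ 2 ≤ G k := fun k => by
    rw [hGdef]
    exact lagrangian_gap_lower hg1sc hg2conv hmin (y k)
  have hG0 : ∀ k, 0 ≤ G k := fun k => (by positivity : 0 ≤ μ / 2 * ‖y k - ys‖ ^ 2).trans (hG k)
  have hE1 : E1 = t 1 ^ 2 * G 1 + t 1 ^ 2 / (2 * β) * ‖y 1 - ys‖ ^ 2 +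
      1 / (2 * γ) * ‖lam 1 - lams‖ ^ 2 := by
    rw [hGdef, map_sub]
  have hvk : ∀ k ≥ 1, v k = y k + (t k - 1) • (y k - y (k - 1)) := by
    intro k hk
    rcases hk.eq_or_lt with rfl | hk
    · simp [hv1, hy0]
    · obtain ⟨j, rfl⟩ : ∃ j, k = j + 1 := ⟨k - 1, by omega⟩
      exact hvupd j (by omega)
  have ht0 : ∀ k ≥ 1, t (k + 1) ≠ 0 := fun k _ => by
    have := ht1 (k + 1) (by omega)
    positivity
  have hstep : ∀ k ≥ 1, v (k + 1) - v k = t (k + 1) • (y (k + 1) - ybar k) := by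
    intro k hk
    have h1 : t (k + 1) • ybar k = t (k + 1) • y k + (v k - y k) := by
      rw [hybar k hk, smul_add, smul_smul, mul_div_cancel₀ _ (ht0 k hk), hvk k hk,
        add_sub_cancel_left]
    rw [smul_sub, h1, hvupd k hk]
    module
  have hbound := fun k (hk : 1 ≤ k) => energy_bound hLg2 hg1sc hg2conv hg2grad hg2lip hβ hγ ht1
    htmono hβle htrec htrec2 hv1 hstep hlambar hζ
    (fun k hk => by
      rw [hv k hk, smul_neg, smul_smul, mul_div_cancel₀ _ (ht0 k hk)])
    hvupd hlam hGdef hG k hk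
  rw [← hE1] at hbound
  have hE10 : 0 ≤ E1 := le_trans (add_nonneg (mul_nonneg (sq_nonneg _) (hG0 1)) (by positivity))
    (hbound 1 le_rfl)
  have hdual : ∀ k ≥ 1, ‖lam k - lams‖ ≤ Real.sqrt (2 * γ * E1) := fun k hk => by
    apply Real.le_sqrt_of_sq_le
    have h1 := hbound k hk
    have h2 := mul_nonneg (sq_nonneg (t k)) (hG0 k)
    have h3 : 1 / (2 * γ) * ‖lam k - lams‖ ^ 2 ≤ E1 := by linarith
    rw [one_div_mul_eq_div, div_le_iff₀ (by positivity)] at h3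
    linarith
  have hfeas : ∀ k ≥ 1, t k ^ 2 * ‖B (y k - ys)‖ ≤
      2 * (t 1 ^ 2 * ‖B (y 1 - ys)‖ + (‖lam 1 - lams‖ + Real.sqrt (2 * γ * E1)) / γ) := by
    refine fun k hk => feasibility_bound ht1 htrec (r := fun k => B (y k - ys))
      (S := fun k => t 1 ^ 2 • B (y 1 - ys) + (1 / γ) • (lam k - lam 1)) (by simp)
      (fun k hk => ?_) (fun k hk => ?_) k hk
    · have h1 : v (k + 1) - ys = t (k + 1) • (y (k + 1) - ys) - (t (k + 1) - 1) • (y k - ys) := by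
        rw [hvupd k hk]
        module
      have h2 : (1 / γ) • (γ * t (k + 1)) • B (v (k + 1) - ys) =
          t (k + 1) ^ 2 • B (y (k + 1) - ys) - (t (k + 1) ^ 2 - t (k + 1)) • B (y k - ys) := by
        rw [smul_smul, ← mul_assoc, one_div_mul_cancel hγ.ne', one_mul, h1]
        simp only [map_sub, map_smul]
        module
      rw [hlam k hk, add_sub_right_comm, smul_add, h2]
      abel
    · refine (norm_add_le _ _).trans ?_
      rw [norm_smul, norm_smul, Real.norm_of_nonneg (sq_nonneg _),
        Real.norm_of_nonneg (one_div_nonneg.2 hγ.le), one_div_mul_eq_div]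
      gcongr
      calc ‖lam k - lam 1‖ = ‖(lam k - lams) - (lam 1 - lams)‖ := by rw [sub_sub_sub_cancel_right]
        _ ≤ ‖lam k - lams‖ + ‖lam 1 - lams‖ := norm_sub_le _ _
        _ ≤ _ := by linarith [hdual k hk]
  intro k hk
  have htk : 0 < t k ^ 2 := by
    have := ht1 k hk
    positivity
  have hr : t k ^ 2 * ‖B (y k - ys)‖ ≤ C4 := by
    refine (hfeas k hk).trans ?_
    have h1 : 0 ≤ t 1 ^ 2 * ‖B (y 1 - ys)‖ := by positivity
    have h2 : C4 = 3 * (t 1 ^ 2 * ‖B (y 1 - ys)‖) +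
        2 * ((‖lam 1 - lams‖ + Real.sqrt (2 * γ * E1)) / γ) := by
      rw [map_sub]
      ring
    linarith
  rw [← map_sub, le_div_iff₀ htk, le_div_iff₀ htk]
  refine ⟨by linarith, ?_⟩
  have h1 : |g1 (y k) + g2 (y k) - (g1 ys + g2 ys)| ≤ G k + ‖lams‖ * ‖B (y k - ys)‖ := by
    have h2 := abs_le.1 (abs_real_inner_le_norm lams (B (y k - ys)))
    have h3 := hG0 k
    have h4 := hGdef k
    rw [abs_le]
    constructor <;> linarith
  have h2 : t k ^ 2 * G k ≤ E1 := by
    have : 0 ≤ 1 / (2 * γ) * ‖lam k - lams‖ ^ 2 := by positivity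
    linarith [hbound k hk]
  have h3 := mul_le_mul_of_nonneg_right h1 htk.le
  have h4 := mul_le_mul_of_nonneg_right hr (norm_nonneg lams)
  linarith
end

section
/- (Convergence of hybrid Algorithm 7.) Under the Problem setup, let {(x_k, y_k, λ_k, u_k, v_k)}_{k≥1} satisfy Scheme C, and let (x*, y*, λ*) ∈ Ω. Assume α ≤ 1/L_{f2} and {t_k}_{k≥1} ⊆ [1, +∞) is nondecreasing with t_{k+1}² ≤ t_k² + t_{k+1} for all k ≥ 1. Suppose either (Option 1) λ̂_{k+1} = λ_{k+1} with β ≤ t_1²/L_{g2} and t_{k+1}² ≤ t_k² + (β·μ_g/(1 + β·γ·‖B‖²))·t_k for all k ≥ 1, or (Option 2) λ̂_{k+1} = λ̄_{k+1} with β ≤ t_1²/(L_{g2} + t_1²·γ·‖B‖²) and t_{k+1}² ≤ t_k² + β·μ_g·t_k for all k ≥ 1. Then there exists C > 0 such that for all k ≥ 1: 𝓛(x_k, y_k, λ*) − 𝓛(x*, y*, λ*) ≤ C/t_k², ‖A x_k + B y_k − b‖ ≤ C/t_k², and |f(x_k) + g(y_k) − f(x*) − g(y*)| ≤ C/t_k².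 -/
set_option autoImplicit false

open RealInnerProductSpace

/-- The Lagrangian `𝓛(x,y,λ) = f1 x + f2 x + g1 y + g2 y + ⟪λ, Ax + By − b⟫`. -/
noncomputable def Lagr {m n p : ℕ}
    (f1 f2 : EuclideanSpace ℝ (Fin m) → ℝ)
    (g1 g2 : EuclideanSpace ℝ (Fin n) → ℝ)
    (A : EuclideanSpace ℝ (Fin m) →L[ℝ] EuclideanSpace ℝ (Fin p))
    (B : EuclideanSpace ℝ (Fin n) →L[ℝ] EuclideanSpace ℝ (Fin p))
    (b : EuclideanSpace ℝ (Fin p))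
    (x : EuclideanSpace ℝ (Fin m)) (y : EuclideanSpace ℝ (Fin n))
    (l : EuclideanSpace ℝ (Fin p)) : ℝ :=
  f1 x + f2 x + g1 y + g2 y + ⟪l, A x + B y - b⟫

section Convexity

variable {E : Type*} [NormedAddCommGroup E] [InnerProductSpace ℝ E]

/-- A subgradient of a strongly convex function satisfies the quadratically improved subgradient
inequality. -/
theorem StrongConvexOn.add_inner_add_sq_le {g : E → ℝ} {μ : ℝ}
    (hg : StrongConvexOn Set.univ μ g) {y ζ : E} (hζ : ∀ z, g y + ⟪ζ, z - y⟫ ≤ g z) (z : E) :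
    g y + ⟪ζ, z - y⟫ + μ / 2 * ‖z - y‖ ^ 2 ≤ g z := by
  have key : ∀ a ∈ Set.Ioo (0 : ℝ) 1,
      g y + ⟪ζ, z - y⟫ + (1 - a) * (μ / 2 * ‖z - y‖ ^ 2) ≤ g z := by
    rintro a ⟨ha0, ha1⟩
    have h1 := hg.2 (Set.mem_univ z) (Set.mem_univ y) ha0.le (sub_nonneg.2 ha1.le) (by ring)
    have h2 := hζ (a • z + (1 - a) • y)
    rw [show a • z + (1 - a) • y - y = a • (z - y) by module, inner_smul_right] at h2
    simp only [smul_eq_mul] at h1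
    refine le_of_mul_le_mul_left ?_ ha0
    linarith
  have hlim : Filter.Tendsto
      (fun a : ℝ => g y + ⟪ζ, z - y⟫ + (1 - a) * (μ / 2 * ‖z - y‖ ^ 2))
      (nhdsWithin 0 (Set.Ioi 0)) (nhds (g y + ⟪ζ, z - y⟫ + (1 - 0) * (μ / 2 * ‖z - y‖ ^ 2))) :=
    (Continuous.tendsto (by fun_prop) 0).mono_left nhdsWithin_le_nhds
  have := le_of_tendsto hlim
    (Filter.mem_of_superset (Ioo_mem_nhdsGT zero_lt_one) key)
  simpa using this

variable [CompleteSpace E]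

theorem HasGradientAt.hasDerivAt_comp_line {f : E → ℝ} {G x d : E} {s : ℝ}
    (h : HasGradientAt f G (x + s • d)) :
    HasDerivAt (fun r : ℝ => f (x + r • d)) ⟪G, d⟫ s := by
  have hl : HasDerivAt (fun r : ℝ => x + r • d) d s := by
    simpa using ((hasDerivAt_id s).smul_const d).const_add x
  exact (h.hasFDerivAt.comp_hasDerivAt s hl).congr_deriv (by simp)

theorem ConvexOn.add_inner_gradient_le {f : E → ℝ} (hf : ConvexOn ℝ Set.univ f) {G x : E}
    (h : HasGradientAt f G x) (z : E) : f x + ⟪G, z - x⟫ ≤ f z := by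
  have hd : HasDerivAt (fun r : ℝ => f (x + r • (z - x))) ⟪G, z - x⟫ 0 :=
    HasGradientAt.hasDerivAt_comp_line (by simpa using h)
  have hc : ConvexOn ℝ Set.univ (fun r : ℝ => f (x + r • (z - x))) := by
    refine ⟨convex_univ, fun a _ b _ p q hp hq hpq => ?_⟩
    have := hf.2 (Set.mem_univ (x + a • (z - x))) (Set.mem_univ (x + b • (z - x))) hp hq hpq
    convert this using 2
    rw [show x + (p • a + q • b) • (z - x) = (1 : ℝ) • x + (p • a + q • b) • (z - x) by simp,
      ← hpq]
    simp only [smul_eq_mul]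
    module
  have := hc.le_slope_of_hasDerivAt (Set.mem_univ 0) (Set.mem_univ 1) zero_lt_one hd
  simp only [slope, sub_zero, inv_one, one_smul, zero_smul, add_zero, add_sub_cancel,
    vsub_eq_sub] at this
  linarith

/-- The descent lemma for functions with Lipschitz gradient. -/
theorem le_add_inner_gradient_add_sq {f : E → ℝ} {f' : E → E} {L : ℝ}
    (hgrad : ∀ x, HasGradientAt f (f' x) x) (hlip : ∀ x y, ‖f' x - f' y‖ ≤ L * ‖x - y‖)
    (x z : E) : f z ≤ f x + ⟪f' x, z - x⟫ + L / 2 * ‖z - x‖ ^ 2 := by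
  set d := z - x with hd
  have hf : ∀ s : ℝ, HasDerivAt (fun r : ℝ => f (x + r • d)) ⟪f' (x + s • d), d⟫ s :=
    fun s => (hgrad _).hasDerivAt_comp_line
  have hB : ∀ s : ℝ, HasDerivAt (fun r : ℝ => f x + r * ⟪f' x, d⟫ + L / 2 * ‖d‖ ^ 2 * r ^ 2)
      (⟪f' x, d⟫ + L * ‖d‖ ^ 2 * s) s := by
    intro s
    exact ((((hasDerivAt_id s).mul_const ⟪f' x, d⟫).const_add (f x)).add
      (((hasDerivAt_id s).pow 2).const_mul (L / 2 * ‖d‖ ^ 2))).congr_deriv (by simp; ring)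
  have := image_le_of_deriv_right_le_deriv_boundary (a := 0) (b := 1)
    (fun s _ => (hf s).continuousAt.continuousWithinAt) (fun s _ => (hf s).hasDerivWithinAt)
    (by simp) (fun s _ => (hB s).continuousAt.continuousWithinAt)
    (fun s _ => (hB s).hasDerivWithinAt) (fun s hs => ?_) (Set.right_mem_Icc.2 zero_le_one)
  · simpa [hd] using this
  · have h1 : ⟪f' (x + s • d) - f' x, d⟫ ≤ L * ‖d‖ ^ 2 * s := by
      refine (real_inner_le_norm _ _).trans ?_
      have h2 := hlip (x + s • d) x
      rw [add_sub_cancel_left, norm_smul, Real.norm_of_nonneg hs.1] at h2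
      nlinarith [norm_nonneg d]
    rw [inner_sub_left] at h1
    linarith

/-- One accelerated step for a smooth convex function, the gradient being evaluated at the
extrapolated point. -/
theorem accelerated_smooth_step {f : E → ℝ} {f' : E → E} {L t : ℝ}
    (hf : ConvexOn ℝ Set.univ f) (hgrad : ∀ x, HasGradientAt f (f' x) x)
    (hlip : ∀ x y, ‖f' x - f' y‖ ≤ L * ‖x - y‖) (ht : 1 ≤ t) {x₀ x₁ xb u₀ u₁ : E}
    (hx₁ : x₁ = (1 / t) • u₁ + ((t - 1) / t) • x₀)
    (hxb : xb = (1 / t) • u₀ + ((t - 1) / t) • x₀) (s : E) :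
    t ^ 2 * (f x₁ - f s) - t * (t - 1) * (f x₀ - f s) ≤
      t * ⟪f' xb, u₁ - s⟫ + L / 2 * ‖u₁ - u₀‖ ^ 2 := by
  have ht0 : t ≠ 0 := by positivity
  have hdesc := le_add_inner_gradient_add_sq hgrad hlip xb x₁
  have h0 := hf.add_inner_gradient_le (hgrad xb) x₀
  have hs := hf.add_inner_gradient_le (hgrad xb) s
  have hnorm : t ^ 2 * ‖x₁ - xb‖ ^ 2 = ‖u₁ - u₀‖ ^ 2 := by
    have : u₁ - u₀ = t • (x₁ - xb) := by
      rw [hx₁, hxb]; match_scalars <;> field_simp; ring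
    rw [this, norm_smul, mul_pow, Real.norm_eq_abs, sq_abs]
  have hin : t * ⟪f' xb, u₁ - s⟫ = t ^ 2 * ⟪f' xb, x₁ - xb⟫ - t * (t - 1) * ⟪f' xb, x₀ - xb⟫
      - t * ⟪f' xb, s - xb⟫ := by
    simp only [← inner_smul_right, ← inner_sub_right]
    congr 1
    rw [hx₁]; match_scalars <;> field_simp <;> ring
  have e1 := mul_le_mul_of_nonneg_left hdesc (sq_nonneg t)
  have e2 := mul_le_mul_of_nonneg_left h0 
    (mul_nonneg (by linarith) (sub_nonneg.2 ht) : 0 ≤ t * (t - 1))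
  have e3 := mul_le_mul_of_nonneg_left hs (by linarith : 0 ≤ t)
  have e4 : L / 2 * (t ^ 2 * ‖x₁ - xb‖ ^ 2) = L / 2 * ‖u₁ - u₀‖ ^ 2 := by rw [hnorm]
  linarith

/-- One step of the primal block whose subgradient is taken at the auxiliary iterate. -/
theorem convex_block_step {f₁ f₂ : E → ℝ} {f₂' : E → E} {L α t : ℝ}
    (hf₁ : ConvexOn ℝ Set.univ f₁)
    (hf₂ : ConvexOn ℝ Set.univ f₂) (hgrad : ∀ x, HasGradientAt f₂ (f₂' x) x)
    (hlip : ∀ x y, ‖f₂' x - f₂' y‖ ≤ L * ‖x - y‖) (ht : 1 ≤ t) (hα : 0 < α) (hαL : α * L ≤ 1)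
    {x₀ x₁ xb u₀ u₁ ξ q : E}
    (hx₁ : x₁ = (1 / t) • u₁ + ((t - 1) / t) • x₀)
    (hxb : xb = (1 / t) • u₀ + ((t - 1) / t) • x₀)
    (hξ : ∀ z, f₁ u₁ + ⟪ξ, z - u₁⟫ ≤ f₁ z)
    (hu : u₁ - u₀ = -((α * t) • (ξ + f₂' xb + q))) (s : E) :
    t ^ 2 * (f₁ x₁ + f₂ x₁ - (f₁ s + f₂ s)) - t * (t - 1) * (f₁ x₀ + f₂ x₀ - (f₁ s + f₂ s)) ≤
      1 / (2 * α) * ‖u₀ - s‖ ^ 2 - 1 / (2 * α) * ‖u₁ - s‖ ^ 2 - t * ⟪q, u₁ - s⟫ := by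
  have ht0 : 0 < t := by linarith
  have hsm := accelerated_smooth_step hf₂ hgrad hlip ht hx₁ hxb s
  have hcv : t * f₁ x₁ ≤ f₁ u₁ + (t - 1) * f₁ x₀ := by
    have := hf₁.2 (Set.mem_univ u₁) (Set.mem_univ x₀) (by positivity : 0 ≤ 1 / t)
      (div_nonneg (sub_nonneg.2 ht) ht0.le) (by field_simp; ring)
    rw [← hx₁, smul_eq_mul, smul_eq_mul] at this
    calc t * f₁ x₁ ≤ t * (1 / t * f₁ u₁ + (t - 1) / t * f₁ x₀) := by gcongr
      _ = _ := by field_simp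
  have hsub := hξ s
  have hinner : ⟪u₁ - u₀, u₁ - s⟫ = -(α * t) * (⟪ξ, u₁ - s⟫ + ⟪f₂' xb, u₁ - s⟫ + ⟪q, u₁ - s⟫) := by
    rw [hu, ← neg_smul, inner_smul_left, inner_add_left, inner_add_left]; simp
  have hpol : ‖u₀ - s‖ ^ 2 = ‖u₁ - s‖ ^ 2 - 2 * ⟪u₁ - u₀, u₁ - s⟫ + ‖u₁ - u₀‖ ^ 2 := by
    rw [show u₀ - s = (u₁ - s) - (u₁ - u₀) by abel, norm_sub_sq_real,
      real_inner_comm]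
  have hneg : ⟪ξ, s - u₁⟫ = -⟪ξ, u₁ - s⟫ := by rw [← inner_neg_right, neg_sub]
  have hL : L / 2 * ‖u₁ - u₀‖ ^ 2 ≤ 1 / (2 * α) * ‖u₁ - u₀‖ ^ 2 := by
    refine mul_le_mul_of_nonneg_right ?_ (sq_nonneg _)
    rw [div_le_div_iff₀ (by norm_num) (by positivity)]; linarith
  have hexp : 1 / (2 * α) * ‖u₀ - s‖ ^ 2 - 1 / (2 * α) * ‖u₁ - s‖ ^ 2 =
      t * (⟪ξ, u₁ - s⟫ + ⟪f₂' xb, u₁ - s⟫ + ⟪q, u₁ - s⟫) + 1 / (2 * α) * ‖u₁ - u₀‖ ^ 2 := by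
    rw [hpol, hinner]; field_simp; ring
  have e1 := mul_le_mul_of_nonneg_left hcv ht0.le
  have e2 := mul_le_mul_of_nonneg_left hsub ht0.le
  rw [hneg] at e2
  linarith

/-- One step of the strongly convex primal block whose subgradient is taken at the main iterate. -/
theorem strongConvex_block_step {g₁ g₂ : E → ℝ} {g₂' : E → E} {L β μ t : ℝ}
    (hg₁ : StrongConvexOn Set.univ μ g₁) (hμ : 0 ≤ μ)
    (hg₂ : ConvexOn ℝ Set.univ g₂) (hgrad : ∀ x, HasGradientAt g₂ (g₂' x) x)
    (hlip : ∀ x y, ‖g₂' x - g₂' y‖ ≤ L * ‖x - y‖) (ht : 1 ≤ t) (hβ : 0 < β)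
    {y₀ y₁ yb v₀ v₁ ζ q : E}
    (hy₁ : y₁ = (1 / t) • v₁ + ((t - 1) / t) • y₀)
    (hyb : yb = (1 / t) • v₀ + ((t - 1) / t) • y₀)
    (hζ : ∀ z, g₁ y₁ + ⟪ζ, z - y₁⟫ ≤ g₁ z)
    (hv : v₁ - v₀ = -((β / t) • (ζ + g₂' yb + q + μ • (v₁ - y₁)))) (s : E) :
    t ^ 2 * (g₁ y₁ + g₂ y₁ - (g₁ s + g₂ s)) - t * (t - 1) * (g₁ y₀ + g₂ y₀ - (g₁ s + g₂ s)) ≤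
      t ^ 2 / (2 * β) * ‖v₀ - s‖ ^ 2 - t ^ 2 / (2 * β) * ‖v₁ - s‖ ^ 2
        - μ * t / 2 * ‖v₁ - s‖ ^ 2 - (t ^ 2 / β - L) / 2 * ‖v₁ - v₀‖ ^ 2 - t * ⟪q, v₁ - s⟫ := by
  have ht0 : 0 < t := by linarith
  have hsm := accelerated_smooth_step hg₂ hgrad hlip ht hy₁ hyb s
  have hs := hg₁.add_inner_add_sq_le hζ s
  have h0 := hζ y₀
  have hinner : ⟪v₁ - v₀, v₁ - s⟫ = -(β / t) * (⟪ζ, v₁ - s⟫ + ⟪g₂' yb, v₁ - s⟫ + ⟪q, v₁ - s⟫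
      + μ * ⟪v₁ - y₁, v₁ - s⟫) := by
    rw [hv, ← neg_smul, inner_smul_left, inner_add_left, inner_add_left, inner_add_left,
      inner_smul_left]
    simp
  have hpol : ‖v₀ - s‖ ^ 2 = ‖v₁ - s‖ ^ 2 - 2 * ⟪v₁ - v₀, v₁ - s⟫ + ‖v₁ - v₀‖ ^ 2 := by
    rw [show v₀ - s = (v₁ - s) - (v₁ - v₀) by abel, norm_sub_sq_real, real_inner_comm]
  have hpol' : ‖s - y₁‖ ^ 2 = ‖v₁ - s‖ ^ 2 - 2 * ⟪v₁ - y₁, v₁ - s⟫ + ‖v₁ - y₁‖ ^ 2 := by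
    rw [norm_sub_rev, show y₁ - s = (v₁ - s) - (v₁ - y₁) by abel, norm_sub_sq_real,
      real_inner_comm]
  have hin : t * ⟪ζ, v₁ - s⟫ = -(t * (t - 1) * ⟪ζ, y₀ - y₁⟫) - t * ⟪ζ, s - y₁⟫ := by
    simp only [← inner_smul_right, ← inner_sub_right, ← inner_neg_right]
    congr 1
    rw [hy₁]; match_scalars <;> field_simp <;> ring
  have hexp : t ^ 2 / (2 * β) * ‖v₀ - s‖ ^ 2 - t ^ 2 / (2 * β) * ‖v₁ - s‖ ^ 2 =
      t * (⟪ζ, v₁ - s⟫ + ⟪g₂' yb, v₁ - s⟫ + ⟪q, v₁ - s⟫ + μ * ⟪v₁ - y₁, v₁ - s⟫)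
        + t ^ 2 / β / 2 * ‖v₁ - v₀‖ ^ 2 := by
    rw [hpol, hinner]; field_simp; ring
  have e1 := mul_le_mul_of_nonneg_left hs ht0.le
  have e2 := mul_le_mul_of_nonneg_left h0 (mul_nonneg ht0.le (sub_nonneg.2 ht))
  rw [hpol'] at e1
  have e3 : 0 ≤ t * (μ / 2 * ‖v₁ - y₁‖ ^ 2) := by positivity
  linarith

end Convexity

section Multipliers

variable {F H : Type*} [NormedAddCommGroup F] [NormedSpace ℝ F]
  [NormedAddCommGroup H] [InnerProductSpace ℝ H]

theorem inner_multiplier_residual_le {γ t : ℝ} (hγ : 0 < γ) {l₀ l₁ ls r e : H}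
    (hl : l₁ = l₀ + (γ * t) • r) :
    t * ⟪ls - l₁, r⟫ + γ * t ^ 2 * ⟪e, r⟫ ≤
      1 / (2 * γ) * ‖l₀ - ls‖ ^ 2 - 1 / (2 * γ) * ‖l₁ - ls‖ ^ 2 + γ * t ^ 2 / 2 * ‖e‖ ^ 2 := by
  have h1 : ‖l₀ - ls‖ ^ 2 = ‖l₁ - ls‖ ^ 2 + 2 * (γ * t * ⟪ls - l₁, r⟫) + (γ * t) ^ 2 * ‖r‖ ^ 2 := by
    rw [show l₀ - ls = (l₁ - ls) - (γ * t) • r by rw [hl]; abel, norm_sub_sq_real,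
      inner_smul_right, norm_smul, mul_pow, Real.norm_eq_abs, sq_abs,
      ← neg_sub ls l₁, inner_neg_left, norm_neg]
    ring
  have h2 := norm_sub_sq_real e r
  have h3 : 0 ≤ γ * t ^ 2 / 2 * ‖e - r‖ ^ 2 := by positivity
  rw [h2] at h3
  have h4 : 1 / (2 * γ) * ‖l₀ - ls‖ ^ 2 - 1 / (2 * γ) * ‖l₁ - ls‖ ^ 2 =
      t * ⟪ls - l₁, r⟫ + γ * t ^ 2 / 2 * ‖r‖ ^ 2 := by
    rw [h1]; field_simp; ring
  linarith

/-- Coupling terms when both primal blocks use different multipliers: the `y`-block uses the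
updated multiplier. Here `a = A (u₁ - xs)` and `w₀`, `w₁` are the images of the `y`-errors. -/
theorem coupling_updated_multiplier_le {γ t : ℝ} (hγ : 0 < γ) {l₀ l₁ lb ls a w₀ w₁ : H}
    (hl : l₁ = l₀ + (γ * t) • (a + w₁)) (hlb : lb = l₀ + (γ * t) • (a + w₀)) :
    t * ⟪ls, a + w₁⟫ - t * ⟪lb, a⟫ - t * ⟪l₁, w₁⟫ ≤
      1 / (2 * γ) * ‖l₀ - ls‖ ^ 2 - 1 / (2 * γ) * ‖l₁ - ls‖ ^ 2
        + γ * t ^ 2 / 2 * ‖w₀‖ ^ 2 - γ * t ^ 2 / 2 * ‖w₁‖ ^ 2 := by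
  have h := inner_multiplier_residual_le hγ hl (ls := ls) (e := w₁ - w₀)
  have hb : lb = l₁ - (γ * t) • (w₁ - w₀) := by rw [hl, hlb]; module
  have hn : ‖w₀‖ ^ 2 = ‖w₁‖ ^ 2 - 2 * ⟪w₁ - w₀, w₁⟫ + ‖w₁ - w₀‖ ^ 2 := by
    rw [show w₀ = w₁ - (w₁ - w₀) by abel, norm_sub_sq_real, real_inner_comm]
    simp
  rw [hb]
  simp only [inner_add_right, inner_sub_left, inner_smul_left, conj_trivial] at h hn ⊢
  rw [hn]
  linarith

/-- Coupling terms when both primal blocks use the same predicted multiplier. -/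
theorem coupling_predicted_multiplier_le {γ t : ℝ} (hγ : 0 < γ) {l₀ l₁ lb ls a w₀ w₁ : H}
    (hl : l₁ = l₀ + (γ * t) • (a + w₁)) (hlb : lb = l₀ + (γ * t) • (a + w₀)) :
    t * ⟪ls, a + w₁⟫ - t * ⟪lb, a⟫ - t * ⟪lb, w₁⟫ ≤
      1 / (2 * γ) * ‖l₀ - ls‖ ^ 2 - 1 / (2 * γ) * ‖l₁ - ls‖ ^ 2
        + γ * t ^ 2 / 2 * ‖w₁ - w₀‖ ^ 2 := by
  have h := inner_multiplier_residual_le hγ hl (ls := ls) (e := w₁ - w₀)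
  have hb : lb = l₁ - (γ * t) • (w₁ - w₀) := by rw [hl, hlb]; module
  rw [hb]
  simp only [inner_add_right, inner_sub_left, inner_smul_left, conj_trivial] at h ⊢
  linarith

theorem ContinuousLinearMap.norm_apply_sq_le (B : F →L[ℝ] H) (w : F) :
    ‖B w‖ ^ 2 ≤ ‖B‖ ^ 2 * ‖w‖ ^ 2 := by
  rw [← mul_pow]
  gcongr
  exact B.le_opNorm w

/-- Decrease of the potential `‖w‖ ^ 2 / β + γ * ‖B w‖ ^ 2` of the `y`-error together with the dual
distance, when the `y`-block uses the updated multiplier. -/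
theorem updated_multiplier_potential_le {B : F →L[ℝ] H} {β γ t L : ℝ} (hβ : 0 < β) (hγ : 0 < γ)
    (hL : L ≤ t ^ 2 / β) {l₀ l₁ lb ls a : H} {v₀ v₁ s : F}
    (hl : l₁ = l₀ + (γ * t) • (a + B (v₁ - s))) (hlb : lb = l₀ + (γ * t) • (a + B (v₀ - s))) :
    t ^ 2 / (2 * β) * ‖v₀ - s‖ ^ 2 - t ^ 2 / (2 * β) * ‖v₁ - s‖ ^ 2
        - (t ^ 2 / β - L) / 2 * ‖v₁ - v₀‖ ^ 2
        + (t * ⟪ls, a + B (v₁ - s)⟫ - t * ⟪lb, a⟫ - t * ⟪l₁, B (v₁ - s)⟫) ≤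
      t ^ 2 / 2 * (‖v₀ - s‖ ^ 2 / β + γ * ‖B (v₀ - s)‖ ^ 2)
        - t ^ 2 / 2 * (‖v₁ - s‖ ^ 2 / β + γ * ‖B (v₁ - s)‖ ^ 2)
        + 1 / (2 * γ) * ‖l₀ - ls‖ ^ 2 - 1 / (2 * γ) * ‖l₁ - ls‖ ^ 2 := by
  have hc := coupling_updated_multiplier_le hγ hl hlb (ls := ls)
  have hn := mul_nonneg (sub_nonneg.2 hL) (sq_nonneg ‖v₁ - v₀‖)
  have h0 : t ^ 2 / (2 * β) * ‖v₀ - s‖ ^ 2 = t ^ 2 / 2 * (‖v₀ - s‖ ^ 2 / β) := by field_simp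
  have h1 : t ^ 2 / (2 * β) * ‖v₁ - s‖ ^ 2 = t ^ 2 / 2 * (‖v₁ - s‖ ^ 2 / β) := by field_simp
  linarith

/-- Decrease of the potential `‖w‖ ^ 2 / β` of the `y`-error together with the dual distance, when
the `y`-block uses the predicted multiplier. -/
theorem predicted_multiplier_potential_le {B : F →L[ℝ] H} {β γ t L : ℝ} (hβ : 0 < β) (hγ : 0 < γ)
    (hL : L + t ^ 2 * γ * ‖B‖ ^ 2 ≤ t ^ 2 / β) {l₀ l₁ lb ls a : H} {v₀ v₁ s : F}
    (hl : l₁ = l₀ + (γ * t) • (a + B (v₁ - s))) (hlb : lb = l₀ + (γ * t) • (a + B (v₀ - s))) :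
    t ^ 2 / (2 * β) * ‖v₀ - s‖ ^ 2 - t ^ 2 / (2 * β) * ‖v₁ - s‖ ^ 2
        - (t ^ 2 / β - L) / 2 * ‖v₁ - v₀‖ ^ 2
        + (t * ⟪ls, a + B (v₁ - s)⟫ - t * ⟪lb, a⟫ - t * ⟪lb, B (v₁ - s)⟫) ≤
      t ^ 2 / 2 * (‖v₀ - s‖ ^ 2 / β) - t ^ 2 / 2 * (‖v₁ - s‖ ^ 2 / β)
        + 1 / (2 * γ) * ‖l₀ - ls‖ ^ 2 - 1 / (2 * γ) * ‖l₁ - ls‖ ^ 2 := by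
  have hc := coupling_predicted_multiplier_le hγ hl hlb (ls := ls)
  rw [← map_sub, sub_sub_sub_cancel_right] at hc
  have hB := mul_le_mul_of_nonneg_left (B.norm_apply_sq_le (v₁ - v₀))
    (by positivity : 0 ≤ γ * t ^ 2 / 2)
  have hn := mul_nonneg (sub_nonneg.2 hL) (sq_nonneg ‖v₁ - v₀‖)
  have h0 : t ^ 2 / (2 * β) * ‖v₀ - s‖ ^ 2 = t ^ 2 / 2 * (‖v₀ - s‖ ^ 2 / β) := by field_simp
  have h1 : t ^ 2 / (2 * β) * ‖v₁ - s‖ ^ 2 = t ^ 2 / 2 * (‖v₁ - s‖ ^ 2 / β) := by field_simp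
  linarith

end Multipliers

/-- If `a (k + 1) - q k • a k` are the increments of a bounded sequence and `0 ≤ q k ≤ 1`, then
`a` is bounded. -/
theorem norm_le_two_mul_of_damped_increments {H : Type*} [NormedAddCommGroup H]
    [NormedSpace ℝ H] {a w : ℕ → H} {q : ℕ → ℝ} {M : ℝ}
    (hq0 : ∀ k ≥ 1, 0 ≤ q k) (hq1 : ∀ k ≥ 1, q k ≤ 1) (hw : ∀ k ≥ 1, ‖w k‖ ≤ M)
    (h1 : a 1 = w 1) (h : ∀ k ≥ 1, a (k + 1) - q k • a k = w (k + 1) - w k) :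
    ∀ k ≥ 1, ‖a k‖ ≤ 2 * M := by
  have key : ∀ k ≥ 1, ‖w k - a k‖ ≤ M := by
    intro k hk
    induction k, hk using Nat.le_induction with
    | base => simpa [h1] using (norm_nonneg _).trans (hw 1 le_rfl)
    | succ k hk ih =>
      have : w (k + 1) - a (k + 1) = q k • (w k - a k) + (1 - q k) • w k := by
        rw [eq_add_of_sub_eq (h k hk)]; module
      rw [this]
      calc _ ≤ ‖q k • (w k - a k)‖ + ‖(1 - q k) • w k‖ := norm_add_le _ _
        _ = q k * ‖w k - a k‖ + (1 - q k) * ‖w k‖ := by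
          rw [norm_smul, norm_smul, Real.norm_of_nonneg (hq0 k hk),
            Real.norm_of_nonneg (sub_nonneg.2 (hq1 k hk))]
        _ ≤ q k * M + (1 - q k) * M :=
          add_le_add (mul_le_mul_of_nonneg_left ih (hq0 k hk))
            (mul_le_mul_of_nonneg_left (hw k hk) (sub_nonneg.2 (hq1 k hk)))
        _ = M := by ring
  intro k hk
  calc ‖a k‖ = ‖w k - (w k - a k)‖ := by simp
    _ ≤ ‖w k‖ + ‖w k - a k‖ := norm_sub_le _ _
    _ ≤ 2 * M := by linarith [hw k hk, key k hk]

/-- The extrapolated point is the combination of the main and auxiliary iterates. -/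
theorem extrapolation_eq_combination {E : Type*} [AddCommGroup E] [Module ℝ E]
    {t : ℕ → ℝ} {x u xbar : ℕ → E} (ht : ∀ k ≥ 1, 1 ≤ t k)
    (hx0 : x 0 = x 1) (hu1 : u 1 = x 1)
    (hxbar : ∀ k ≥ 1, xbar k = x k + ((t k - 1) / t (k + 1)) • (x k - x (k - 1)))
    (hxupd : ∀ k ≥ 1, x (k + 1) =
      (1 / t (k + 1)) • u (k + 1) + ((t (k + 1) - 1) / t (k + 1)) • x k) :
    ∀ k ≥ 1, xbar k = (1 / t (k + 1)) • u k + ((t (k + 1) - 1) / t (k + 1)) • x k := by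
  have hu : ∀ k ≥ 1, u k = x k + (t k - 1) • (x k - x (k - 1)) := by
    intro k hk
    obtain rfl | ⟨j, hj, rfl⟩ : k = 1 ∨ ∃ j ≥ 1, k = j + 1 := by
      rcases hk.eq_or_lt with h | h
      · exact .inl h.symm
      · exact .inr ⟨k - 1, by omega, by omega⟩
    · simp [hx0, hu1]
    · have : t (j + 1) ≠ 0 := by linarith [ht (j + 1) (by omega)]
      rw [Nat.add_sub_cancel, hxupd j hj]
      match_scalars <;> (field_simp; ring)
  intro k hk
  have : t (k + 1) ≠ 0 := by linarith [ht (k + 1) (by omega)]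
  rw [hxbar k hk, hu k hk]
  match_scalars <;> field_simp; ring

set_option maxHeartbeats 500000 in
/-- Convergence of the hybrid accelerated linearized ADMM (Algorithm 5 of Section 4,
Theorem 4.1): `x`-update as in Scheme A, `y`-update as in Scheme B, with either
Option 1 (`λ̂ = λ`) or Option 2 (`λ̂ = λ̄`). -/
theorem stmt17 {m n p : ℕ}
    (A : EuclideanSpace ℝ (Fin m) →L[ℝ] EuclideanSpace ℝ (Fin p))
    (B : EuclideanSpace ℝ (Fin n) →L[ℝ] EuclideanSpace ℝ (Fin p))
    (b : EuclideanSpace ℝ (Fin p))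
    (f1 f2 : EuclideanSpace ℝ (Fin m) → ℝ)
    (g1 g2 : EuclideanSpace ℝ (Fin n) → ℝ)
    (f2' : EuclideanSpace ℝ (Fin m) → EuclideanSpace ℝ (Fin m))
    (g2' : EuclideanSpace ℝ (Fin n) → EuclideanSpace ℝ (Fin n))
    (Lf2 Lg2 μ : ℝ) (hLf2 : 0 ≤ Lf2) (hLg2 : 0 ≤ Lg2) (hμ : 0 < μ)
    -- Assumption 1.1
    (hf1lsc : LowerSemicontinuous f1) (hf1conv : ConvexOn ℝ Set.univ f1)
    (hf2conv : ConvexOn ℝ Set.univ f2)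
    (hf2grad : ∀ x, HasGradientAt f2 (f2' x) x)
    (hf2lip : ∀ x y, ‖f2' x - f2' y‖ ≤ Lf2 * ‖x - y‖)
    (hg1lsc : LowerSemicontinuous g1) (hg1sc : StrongConvexOn Set.univ μ g1)
    (hg2conv : ConvexOn ℝ Set.univ g2)
    (hg2grad : ∀ y, HasGradientAt g2 (g2' y) y)
    (hg2lip : ∀ x y, ‖g2' x - g2' y‖ ≤ Lg2 * ‖x - y‖)
    -- parameters
    (α β γ : ℝ) (hα : 0 < α) (hβ : 0 < β) (hγ : 0 < γ)
    (t : ℕ → ℝ) (ht1 : ∀ k ≥ 1, 1 ≤ t k) (htmono : ∀ k ≥ 1, t k ≤ t (k + 1))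
    (htrec : ∀ k ≥ 1, t (k + 1) ^ 2 ≤ t k ^ 2 + t (k + 1))
    (hαle : α ≤ 1 / Lf2)
    -- iterates of Scheme C (hybrid)
    (x u xbar : ℕ → EuclideanSpace ℝ (Fin m))
    (y v ybar : ℕ → EuclideanSpace ℝ (Fin n))
    (lam lambar lamhat : ℕ → EuclideanSpace ℝ (Fin p))
    (ξ : ℕ → EuclideanSpace ℝ (Fin m)) (ζ : ℕ → EuclideanSpace ℝ (Fin n))
    (hx0 : x 0 = x 1) (hy0 : y 0 = y 1) (hu1 : u 1 = x 1) (hv1 : v 1 = y 1)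
    (hxbar : ∀ k ≥ 1, xbar k = x k + ((t k - 1) / t (k + 1)) • (x k - x (k - 1)))
    (hybar : ∀ k ≥ 1, ybar k = y k + ((t k - 1) / t (k + 1)) • (y k - y (k - 1)))
    (hξ : ∀ k ≥ 1, ∀ z, f1 (u (k + 1)) + ⟪ξ (k + 1), z - u (k + 1)⟫ ≤ f1 z)
    (hu : ∀ k ≥ 1, u (k + 1) - u k =
      -((α * t (k + 1)) • (ξ (k + 1) + f2' (xbar k) +
        ContinuousLinearMap.adjoint A (lambar (k + 1)))))
    (hζ : ∀ k ≥ 1, ∀ z, g1 (y (k + 1)) + ⟪ζ (k + 1), z - y (k + 1)⟫ ≤ g1 z)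
    (hv : ∀ k ≥ 1, v (k + 1) - v k =
      -((β / t (k + 1)) • (ζ (k + 1) + g2' (ybar k) +
        ContinuousLinearMap.adjoint B (lamhat (k + 1)) +
        μ • (v (k + 1) - y (k + 1)))))
    (hxupd : ∀ k ≥ 1, x (k + 1) =
      (1 / t (k + 1)) • u (k + 1) + ((t (k + 1) - 1) / t (k + 1)) • x k)
    (hyupd : ∀ k ≥ 1, y (k + 1) =
      (1 / t (k + 1)) • v (k + 1) + ((t (k + 1) - 1) / t (k + 1)) • y k)
    (hlam : ∀ k ≥ 1, lam (k + 1) =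
      lam k + (γ * t (k + 1)) • (A (u (k + 1)) + B (v (k + 1)) - b))
    (hlambar : ∀ k ≥ 1, lambar (k + 1) =
      lam k + (γ * t (k + 1)) • (A (u (k + 1)) + B (v k) - b))
    (hopt :
      ((∀ k ≥ 1, lamhat (k + 1) = lam (k + 1)) ∧ β ≤ t 1 ^ 2 / Lg2 ∧
        ∀ k ≥ 1, t (k + 1) ^ 2 ≤ t k ^ 2 + β * μ / (1 + β * γ * ‖B‖ ^ 2) * t k) ∨
      ((∀ k ≥ 1, lamhat (k + 1) = lambar (k + 1)) ∧
        β ≤ t 1 ^ 2 / (Lg2 + t 1 ^ 2 * γ * ‖B‖ ^ 2) ∧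
        ∀ k ≥ 1, t (k + 1) ^ 2 ≤ t k ^ 2 + β * μ * t k))
    -- saddle point
    (xs : EuclideanSpace ℝ (Fin m)) (ys : EuclideanSpace ℝ (Fin n))
    (lams : EuclideanSpace ℝ (Fin p))
    (hsaddle : ∀ xx yy ll,
      Lagr f1 f2 g1 g2 A B b xs ys ll ≤ Lagr f1 f2 g1 g2 A B b xs ys lams ∧
      Lagr f1 f2 g1 g2 A B b xs ys lams ≤ Lagr f1 f2 g1 g2 A B b xx yy lams) :
    -- conclusion
    ∃ C > 0, ∀ k ≥ 1,
      Lagr f1 f2 g1 g2 A B b (x k) (y k) lams -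
          Lagr f1 f2 g1 g2 A B b xs ys lams ≤ C / t k ^ 2 ∧
      ‖A (x k) + B (y k) - b‖ ≤ C / t k ^ 2 ∧
      |f1 (x k) + f2 (x k) + g1 (y k) + g2 (y k) -
          (f1 xs + f2 xs + g1 ys + g2 ys)| ≤ C / t k ^ 2 := by
  have ht0 : ∀ k ≥ 1, 0 < t k := fun k hk => by linarith [ht1 k hk]
  have hαL : α * Lf2 ≤ 1 := by
    rcases hLf2.eq_or_lt with h | h
    · simp [← h]
    · rwa [le_div_iff₀ h] at hαle
  have hfeas : A xs + B ys = b := by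
    have h := (hsaddle xs ys (lams + (A xs + B ys - b))).1
    simp only [Lagr, inner_add_left, real_inner_self_eq_norm_sq] at h
    exact sub_eq_zero.1 (norm_eq_zero.1 (pow_eq_zero_iff two_ne_zero |>.1
      (le_antisymm (by linarith) (sq_nonneg ‖A xs + B ys - b‖))))
  have hxb := extrapolation_eq_combination ht1 hx0 hu1 hxbar hxupd
  have hyb := extrapolation_eq_combination ht1 hy0 hv1 hybar hyupd
  set R : ℕ → EuclideanSpace ℝ (Fin p) := fun k => A (x k) + B (y k) - b with hR
  set Φ : ℕ → ℝ := fun k => f1 (x k) + f2 (x k) + g1 (y k) + g2 (y k) -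
    (f1 xs + f2 xs + g1 ys + g2 ys) with hΦ
  set gap : ℕ → ℝ := fun k => Φ k + ⟪lams, R k⟫ with hgap
  have hgap_eq : ∀ k, Lagr f1 f2 g1 g2 A B b (x k) (y k) lams -
      Lagr f1 f2 g1 g2 A B b xs ys lams = gap k := by
    intro k
    simp only [Lagr, hgap, hΦ, hR, hfeas, sub_self, inner_zero_right]
    ring
  have hgap0 : ∀ k, 0 ≤ gap k := fun k => by
    rw [← hgap_eq]; exact sub_nonneg.2 (hsaddle (x k) (y k) lams).2
  have hres : ∀ k, A (u k) + B (v k) - b = A (u k - xs) + B (v k - ys) := fun k => by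
    rw [← hfeas, map_sub, map_sub]; abel
  have hlam' : ∀ k ≥ 1, lam (k + 1) =
      lam k + (γ * t (k + 1)) • (A (u (k + 1) - xs) + B (v (k + 1) - ys)) := fun k hk => by
    rw [hlam k hk, hres]
  have hlambar' : ∀ k ≥ 1, lambar (k + 1) =
      lam k + (γ * t (k + 1)) • (A (u (k + 1) - xs) + B (v k - ys)) := fun k hk => by
    rw [hlambar k hk, ← hfeas, map_sub, map_sub]; congr 2; abel
  have htge : ∀ k ≥ 1, t 1 ≤ t k := fun k hk => by
    induction k, hk using Nat.le_induction with
    | base => rfl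
    | succ k hk ih => exact ih.trans (htmono k hk)
  -- The only difference between the two options is the quadratic potential `N` of the `y`-errors.
  obtain ⟨N, hN0, hNrec, hcoup⟩ : ∃ N : EuclideanSpace ℝ (Fin n) → ℝ, (∀ w, 0 ≤ N w) ∧
      (∀ k ≥ 1, ∀ w, (t (k + 1) ^ 2 - t k ^ 2) * N w ≤ μ * t k * ‖w‖ ^ 2) ∧
      ∀ k ≥ 1, t (k + 1) ^ 2 / (2 * β) * ‖v k - ys‖ ^ 2
          - t (k + 1) ^ 2 / (2 * β) * ‖v (k + 1) - ys‖ ^ 2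
          - (t (k + 1) ^ 2 / β - Lg2) / 2 * ‖v (k + 1) - v k‖ ^ 2
          + (t (k + 1) * ⟪lams, A (u (k + 1) - xs) + B (v (k + 1) - ys)⟫
          - t (k + 1) * ⟪lambar (k + 1), A (u (k + 1) - xs)⟫
          - t (k + 1) * ⟪lamhat (k + 1), B (v (k + 1) - ys)⟫) ≤
        t (k + 1) ^ 2 / 2 * N (v k - ys) - t (k + 1) ^ 2 / 2 * N (v (k + 1) - ys)
          + 1 / (2 * γ) * ‖lam k - lams‖ ^ 2 - 1 / (2 * γ) * ‖lam (k + 1) - lams‖ ^ 2 := by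
    rcases hopt with ⟨hhat, hβle, hrec⟩ | ⟨hhat, hβle, hrec⟩
    · refine ⟨fun w => ‖w‖ ^ 2 / β + γ * ‖B w‖ ^ 2, fun w => by positivity, fun k hk w => ?_,
        fun k hk => ?_⟩
      · have hNle : ‖w‖ ^ 2 / β + γ * ‖B w‖ ^ 2 ≤ (1 + β * γ * ‖B‖ ^ 2) / β * ‖w‖ ^ 2 := by
          have := mul_le_mul_of_nonneg_left (B.norm_apply_sq_le w) hγ.le
          calc _ ≤ ‖w‖ ^ 2 / β + γ * (‖B‖ ^ 2 * ‖w‖ ^ 2) := by linarith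
            _ = _ := by field_simp
        have hpos : 0 < 1 + β * γ * ‖B‖ ^ 2 := by positivity
        have htk := ht0 k hk
        calc _ ≤ (β * μ / (1 + β * γ * ‖B‖ ^ 2) * t k) * (‖w‖ ^ 2 / β + γ * ‖B w‖ ^ 2) :=
              mul_le_mul_of_nonneg_right (by linarith [hrec k hk]) (by positivity)
          _ ≤ (β * μ / (1 + β * γ * ‖B‖ ^ 2) * t k) *
                ((1 + β * γ * ‖B‖ ^ 2) / β * ‖w‖ ^ 2) :=
              mul_le_mul_of_nonneg_left hNle (by positivity)
          _ = _ := by field_simp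
      · have hL : Lg2 ≤ t (k + 1) ^ 2 / β := by
          rcases hLg2.eq_or_lt with h | h
          · rw [← h]; positivity
          · have h1 := htge (k + 1) (by omega)
            have h2 := ht0 1 le_rfl
            rw [le_div_iff₀ h] at hβle
            rw [le_div_iff₀ hβ]
            calc Lg2 * β = β * Lg2 := mul_comm _ _
              _ ≤ t 1 ^ 2 := hβle
              _ ≤ _ := by gcongr
        rw [hhat k hk]
        exact updated_multiplier_potential_le hβ hγ hL (hlam' k hk) (hlambar' k hk)
    · refine ⟨fun w => ‖w‖ ^ 2 / β, fun w => by positivity, fun k hk w => ?_, fun k hk => ?_⟩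
      · calc _ ≤ (β * μ * t k) * (‖w‖ ^ 2 / β) :=
              mul_le_mul_of_nonneg_right (by linarith [hrec k hk]) (by positivity)
          _ = _ := by field_simp
      · have hL : Lg2 + t (k + 1) ^ 2 * γ * ‖B‖ ^ 2 ≤ t (k + 1) ^ 2 / β := by
          have h2 := ht0 1 le_rfl
          have h0 : 0 ≤ Lg2 + t 1 ^ 2 * γ * ‖B‖ ^ 2 := by positivity
          have hpos : 0 < Lg2 + t 1 ^ 2 * γ * ‖B‖ ^ 2 := by
            refine h0.lt_of_ne fun h => ?_
            rw [← h, div_zero] at hβle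
            linarith
          rw [le_div_iff₀ hpos] at hβle
          have h3 : t 1 ^ 2 ≤ t (k + 1) ^ 2 := by gcongr; exact htge (k + 1) (by omega)
          rw [le_div_iff₀ hβ]
          have h4 : β * γ * ‖B‖ ^ 2 ≤ 1 := by
            refine le_of_mul_le_mul_left ?_ (by positivity : 0 < t 1 ^ 2)
            nlinarith [mul_nonneg hβ.le hLg2]
          nlinarith [mul_nonneg (sub_nonneg.2 h3) (sub_nonneg.2 h4)]
        rw [hhat k hk]
        exact predicted_multiplier_potential_le hβ hγ hL (hlam' k hk) (hlambar' k hk)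
  set En : ℕ → ℝ := fun k => t k ^ 2 * gap k + 1 / (2 * α) * ‖u k - xs‖ ^ 2 +
    t (k + 1) ^ 2 / 2 * N (v k - ys) + 1 / (2 * γ) * ‖lam k - lams‖ ^ 2 with hEn
  have hRrec : ∀ k ≥ 1, t (k + 1) ^ 2 • R (k + 1) - (t (k + 1) * (t (k + 1) - 1)) • R k =
      t (k + 1) • (A (u (k + 1)) + B (v (k + 1)) - b) := by
    intro k hk
    have := (ht0 (k + 1) (by omega)).ne'
    simp only [hR]
    rw [hxupd k hk, hyupd k hk]
    simp only [map_add, map_smul]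
    match_scalars <;> (field_simp; try ring)
  have hdesc : ∀ k ≥ 1, En (k + 1) ≤ En k := by
    intro k hk
    have hk' : k + 1 ≥ 1 := by omega
    have hX := convex_block_step hf1conv hf2conv hf2grad hf2lip (ht1 (k + 1) hk') hα hαL
      (hxupd k hk) (hxb k hk) (hξ k hk) (hu k hk) xs
    have hY := strongConvex_block_step hg1sc hμ.le hg2conv hg2grad hg2lip (ht1 (k + 1) hk') hβ
      (hyupd k hk) (hyb k hk) (hζ k hk) (hv k hk) ys
    rw [ContinuousLinearMap.adjoint_inner_left] at hX hY
    have hC := hcoup k hk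
    have hN := hNrec (k + 1) hk' (v (k + 1) - ys)
    have hin : t (k + 1) ^ 2 * ⟪lams, R (k + 1)⟫ - t (k + 1) * (t (k + 1) - 1) * ⟪lams, R k⟫ =
        t (k + 1) * ⟪lams, A (u (k + 1) - xs) + B (v (k + 1) - ys)⟫ := by
      simp only [← inner_smul_right, ← inner_sub_right]
      rw [hRrec k hk, hres]
    have hg := mul_le_mul_of_nonneg_right
      (by linarith [htrec k hk] : t (k + 1) * (t (k + 1) - 1) ≤ t k ^ 2) (hgap0 k)
    simp only [hEn]
    simp only [hgap, hΦ] at hg ⊢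
    linarith
  have hEn_le : ∀ k ≥ 1, En k ≤ En 1 := fun k hk => by
    induction k, hk using Nat.le_induction with
    | base => rfl
    | succ k hk ih => exact (hdesc k hk).trans ih
  have hgap_le : ∀ k ≥ 1, t k ^ 2 * gap k ≤ En 1 := fun k hk => by
    have h1 := hN0 (v k - ys)
    have : 0 ≤ 1 / (2 * α) * ‖u k - xs‖ ^ 2 +
      t (k + 1) ^ 2 / 2 * N (v k - ys) + 1 / (2 * γ) * ‖lam k - lams‖ ^ 2 := by positivity
    have h2 := hEn_le k hk
    simp only [hEn] at h2 ⊢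
    linarith
  have hlam_le : ∀ k ≥ 1, ‖lam k - lams‖ ≤ 1 + 2 * γ * En 1 := fun k hk => by
    have h1 := hN0 (v k - ys)
    have h3 := hgap0 k
    have : 0 ≤ t k ^ 2 * gap k + 1 / (2 * α) * ‖u k - xs‖ ^ 2 +
      t (k + 1) ^ 2 / 2 * N (v k - ys) := by positivity
    have h2 : 1 / (2 * γ) * ‖lam k - lams‖ ^ 2 ≤ En 1 := by
      refine le_trans ?_ (hEn_le k hk)
      simp only [hEn]
      linarith
    have h4 : ‖lam k - lams‖ ^ 2 ≤ 2 * γ * En 1 := by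
      rw [one_div, inv_mul_le_iff₀ (by positivity)] at h2; exact h2
    nlinarith [sq_nonneg (‖lam k - lams‖ - 1)]
  have hE0 : 0 ≤ En 1 := (mul_nonneg (sq_nonneg _) (hgap0 1)).trans (hgap_le 1 le_rfl)
  obtain ⟨K, hK0, hK⟩ : ∃ K, 0 ≤ K ∧ ∀ k ≥ 1, ‖t k ^ 2 • R k‖ ≤ K := by
    set M : ℝ := γ⁻¹ * (2 * (1 + 2 * γ * En 1)) + ‖t 1 ^ 2 • R 1‖ with hM
    have hw : ∀ k ≥ 1, ‖γ⁻¹ • (lam k - lam 1) + t 1 ^ 2 • R 1‖ ≤ M := fun k hk => by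
      refine (norm_add_le _ _).trans (add_le_add_left ?_ _)
      rw [norm_smul, Real.norm_of_nonneg (by positivity)]
      gcongr
      calc ‖lam k - lam 1‖ = ‖(lam k - lams) - (lam 1 - lams)‖ := by congr 1; abel
        _ ≤ ‖lam k - lams‖ + ‖lam 1 - lams‖ := norm_sub_le _ _
        _ ≤ _ := by linarith [hlam_le k hk, hlam_le 1 le_rfl]
    refine ⟨2 * M, by positivity, norm_le_two_mul_of_damped_increments
      (q := fun k => t (k + 1) * (t (k + 1) - 1) / t k ^ 2)
      (fun k hk => ?_) (fun k hk => ?_) hw (by simp) (fun k hk => ?_)⟩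
    · have := ht1 (k + 1) (by omega)
      exact div_nonneg (mul_nonneg (by linarith) (by linarith)) (sq_nonneg _)
    · have := ht0 k hk
      rw [div_le_one (by positivity)]
      linarith [htrec k hk]
    · have := (ht0 k hk).ne'
      rw [smul_smul, div_mul_cancel₀ _ (pow_ne_zero 2 this), hRrec k hk, hlam k hk]
      match_scalars <;> field_simp <;> ring
  refine ⟨En 1 + K + ‖lams‖ * K + 1, by positivity, fun k hk => ?_⟩
  have htk : 0 < t k ^ 2 := pow_pos (ht0 k hk) 2
  have hRk : t k ^ 2 * ‖R k‖ ≤ K := by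
    have := hK k hk
    rwa [norm_smul, Real.norm_of_nonneg htk.le] at this
  have hgk := hgap_le k hk
  have hlK : 0 ≤ ‖lams‖ * K := by positivity
  refine ⟨?_, ?_, ?_⟩
  · rw [hgap_eq, le_div_iff₀ htk]
    linarith
  · rw [le_div_iff₀ htk]
    linarith
  · rw [le_div_iff₀ htk]
    have h1 : |Φ k| ≤ gap k + ‖lams‖ * ‖R k‖ := by
      have h2 := abs_real_inner_le_norm lams (R k)
      have h3 : Φ k = gap k - ⟪lams, R k⟫ := by simp [hgap]
      rw [abs_le] at h2 ⊢
      constructor <;> linarith [hgap0 k]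
    have h4 := mul_le_mul_of_nonneg_right h1 htk.le
    have h5 := mul_le_mul_of_nonneg_left hRk (norm_nonneg lams)
    change |Φ k| * t k ^ 2 ≤ _
    linarith
end
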